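/- The degree-four cobracket is well defined: the homomorphism δ = (δ_{3,1}, δ_{1,3}, δ_{2,2}), followed by (a_3 ⊗ id − id ⊗ a_3, Id), from the free abelian group on generic configurations of 8 points in P³(F) to (B_3(F) ⊗ F*) ⊗ ℚ ⊕ (B_2(F) ∧ B_2(F)) ⊗ ℚ, sends to zero all the defining relations of G̃_4(F): 1) projective invariance, 2) skew-symmetry, 3) the 9-term relation Σ_{i=0}^{8} (−1)^i (l_0,...,l̂_i,...,l_8) = 0 for 9 generic points in P³(F), and 4) the dual 9-term relation Σ_{i=0}^{8} (−1)^i (l_i | l_0,...,l̂_i,...,l_8) = 0 for 9 generic points in P⁴(F). -/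

import Mathlib

noncomputable section
open scoped TensorProduct
open Classical

namespace Gon

variable (F : Type) [Field F]

/-- Points of the projective space `P^{d-1}(F)`, i.e. lines in `F^d`. -/
abbrev Pt (d : ℕ) := Projectivization F (Fin d → F)

variable {F}

/-- Determinant of a `d`-tuple of vectors in `F^d` (w.r.t. the standard volume form). -/
def dt {d : ℕ} (v : Fin d → (Fin d → F)) : F := Matrix.det (Matrix.of v)

/-- `Δ` of three vectors of `F^3`. -/
def det3 (a b c : Fin 3 → F) : F := dt ![a, b, c]

/-- `Δ` of four vectors of `F^4`. -/
def det4 (a b c d : Fin 4 → F) : F := dt ![a, b, c, d]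

/-- Cross-ratio of four points on the projective line. -/
def cr1 (a b c d : Pt F 2) : F :=
  (dt ![a.rep, c.rep] * dt ![b.rep, d.rep]) / (dt ![a.rep, d.rep] * dt ![b.rep, c.rep])

/-- Cross-ratio of the four points of `P^1` obtained by projecting `a b c d` from the
centre `e` in the projective plane. -/
def crFrom3 (e a b c d : Pt F 3) : F :=
  (det3 e.rep a.rep c.rep * det3 e.rep b.rep d.rep) /
    (det3 e.rep a.rep d.rep * det3 e.rep b.rep c.rep)

/-- Cross-ratio of the four points of `P^1` obtained by projecting `a b c d` from the
line through `p` and `q` in `P^3`. -/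
def crLine (p q a b c d : Pt F 4) : F :=
  (det4 p.rep q.rep a.rep c.rep * det4 p.rep q.rep b.rep d.rep) /
    (det4 p.rep q.rep a.rep d.rep * det4 p.rep q.rep b.rep c.rep)

variable (F)

/-- `ℚ[F]`, the free `ℚ`-vector space on the set `F`. -/
abbrev QF := F →₀ ℚ

variable {F}

/-- The generator `{x}` of `ℚ[F]`, with the convention `{0} = {∞} = 0`. -/
def gen (a : F) : QF F := if a = 0 then 0 else Finsupp.single a 1

/-- Make a projective point out of a vector, with a junk value at `0`. -/
def mkPt {d : ℕ} (v : Fin (d + 1) → F) : Pt F (d + 1) :=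
  if h : v ≠ 0 then Projectivization.mk F v h
  else Projectivization.mk F (fun _ => 1) (by
    intro h0; have := congrFun h0 0; simp at this)

/-- Projection of a point `x` of `P^{N-1}` from the centre spanned by the points `c`,
to `P^d` (realized via an arbitrarily chosen identification of the quotient space with
`F^{d+1}`; the resulting configurations are well defined up to projective equivalence). -/
def projection {N : ℕ} (d : ℕ) {k : ℕ} (c : Fin k → Pt F N) (x : Pt F N) : Pt F (d + 1) :=
  let W : Submodule F (Fin N → F) := Submodule.span F (Set.range fun i => (c i).rep)
  if h : Module.finrank F ((Fin N → F) ⧸ W) = d + 1 then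
    mkPt (((Module.finBasis F ((Fin N → F) ⧸ W)).reindex (finCongr h)).equivFun
      (Submodule.Quotient.mk x.rep))
  else mkPt 0

/-- The action of `GL(F^N)` on `P^{N-1}(F)`. -/
def mapPt {N : ℕ} (g : (Fin N → F) ≃ₗ[F] (Fin N → F)) (x : Pt F N) : Pt F N :=
  Projectivization.map g.toLinearMap g.injective x

/-- `sign(I, Ī)`: the sign of the shuffle permutation `(1,...,n) → (I, Ī)`, for a subset
`I ⊆ {1,...,n}` of `{0,1,...,n}`; it equals `(-1)^(Σ_{i∈I} i - |I|(|I|+1)/2)`. -/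
def shufSign {N : ℕ} (I : Finset (Fin N)) : ℤ :=
  (-1) ^ (∑ i ∈ I, (i : ℕ) - I.card * (I.card + 1) / 2)

/-- The tuple of the elements of `S`, listed in increasing order (junk if `c ≠ |S|`). -/
def tupleOf {N : ℕ} {X : Type} (S : Finset (Fin (N + 1))) (x : Fin (N + 1) → X) {c : ℕ} :
    Fin c → X :=
  fun t => x ((S.sort (· ≤ ·)).getD (t : ℕ) 0)

/-- The five term element of `ℚ[F]` attached to five points of the projective line. -/
def fiveTerm (x : Fin 5 → Pt F 2) : QF F :=
  ∑ i : Fin 5, ((-1 : ℤ) ^ (i : ℕ)) •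
    gen (cr1 (x (i.succAbove 0)) (x (i.succAbove 1)) (x (i.succAbove 2)) (x (i.succAbove 3)))

variable (F)

/-- `R_2(F)`: the five-term relations for five distinct points of `P^1(F)`, together with
`{1}` (the generators of `ℤ[F^* ∖ {1}]` omit `1`). -/
def R2 : Submodule ℚ (QF F) :=
  Submodule.span ℚ
    ({z | ∃ x : Fin 5 → Pt F 2, Function.Injective x ∧ z = fiveTerm x} ∪ {gen (1 : F)})

/-- The Bloch group `B_2(F)` (tensored with `ℚ`). -/
abbrev B2 := QF F ⧸ R2 F

def clsB2 : QF F →ₗ[ℚ] B2 F := (R2 F).mkQ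

/-- `{x}_2 ∈ B_2(F)`. -/
def b2 (a : F) : B2 F := clsB2 F (gen a)

variable {F}

variable (F)

/-- triple ratio of six points of the plane. -/
def tripleRatio (x : Fin 6 → Pt F 3) : F :=
  (det3 (x 0).rep (x 1).rep (x 3).rep * det3 (x 1).rep (x 2).rep (x 4).rep *
      det3 (x 2).rep (x 0).rep (x 5).rep) /
    (det3 (x 0).rep (x 1).rep (x 4).rep * det3 (x 1).rep (x 2).rep (x 5).rep *
      det3 (x 2).rep (x 0).rep (x 3).rep)

variable {F}

/-- The generalized cross-ratio `r_3` of six points of `P^2` in generic position: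
`r_3(x_1,...,x_6) = (1/15)·Alt_6 {triple ratio}`, as an element of `ℚ[F]`. -/
def r3free (x : Fin 6 → Pt F 3) : QF F :=
  (1 / 15 : ℚ) • ∑ σ : Equiv.Perm (Fin 6), (Equiv.Perm.sign σ : ℤ) • gen (tripleRatio F (x ∘ σ))

/-- Six points of `P^2` are in generic position: no two coincide, no three collinear. -/
def Generic6 (x : Fin 6 → Pt F 3) : Prop :=
  ∀ a b c : Fin 6, a ≠ b → a ≠ c → b ≠ c → det3 (x a).rep (x b).rep (x c).rep ≠ 0

/-- Kummer's functional equation for the trilogarithm. -/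
def kummer (x y : F) : QF F :=
  -gen (x * (1 - y) ^ 2 / (y * (1 - x) ^ 2)) - gen (x * y) - gen (x / y) - (2 : ℚ) • gen 1 +
    (2 : ℚ) • (gen (-x * (1 - y) / (1 - x)) + gen (x * (1 - y) / (y * (1 - x))) +
      gen (-y * (1 - x) / (1 - y)) + gen ((1 - x) / (1 - y)) + gen y + gen x)

variable (F)

/-- `R_3(F)`: generated by `{x} - {x⁻¹}`, the seven term relations for seven generic
points of the plane, and Kummer's relations. -/
def R3 : Submodule ℚ (QF F) :=
  Submodule.span ℚ
    ({z | ∃ x : F, z = gen x - gen x⁻¹} ∪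
      {z | ∃ x : Fin 7 → Pt F 3, (∀ i j k : Fin 7, i ≠ j → i ≠ k → j ≠ k →
          det3 (x i).rep (x j).rep (x k).rep ≠ 0) ∧
          z = ∑ i : Fin 7, ((-1 : ℤ) ^ (i : ℕ)) • r3free (x ∘ i.succAbove)} ∪
      {z | ∃ x y : F, x ≠ 0 ∧ x ≠ 1 ∧ y ≠ 0 ∧ y ≠ 1 ∧ z = kummer x y})

/-- `B_3(F)` (tensored with `ℚ`). -/
abbrev B3 := QF F ⧸ R3 F

def clsB3 : QF F →ₗ[ℚ] B3 F := (R3 F).mkQ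

/-- `{x}_3 ∈ B_3(F)`. -/
def b3 (a : F) : B3 F := clsB3 F (gen a)

variable {F}

/-- `μ_3`, relative to a given cross-ratio function `cr` (18 terms, with the factor 1/4):
`μ_3(x_1,x_2,x_3;y_1,y_2,y_3) = (1/4)·Alt_{(x)(y)}({r(x_1,y_2,x_2,y_1)} - {r(x_1,y_1,x_2,y_2)})`. -/
def mu3 {P : Type} (cr : P → P → P → P → F) (x y : Fin 3 → P) : QF F :=
  (1 / 4 : ℚ) • ∑ σ : Equiv.Perm (Fin 3), ∑ τ : Equiv.Perm (Fin 3),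
    (((Equiv.Perm.sign σ : ℤ) * (Equiv.Perm.sign τ : ℤ)) : ℤ) •
      (gen (cr (x (σ 0)) (y (τ 1)) (x (σ 1)) (y (τ 0))) -
        gen (cr (x (σ 0)) (y (τ 0)) (x (σ 1)) (y (τ 1))))

variable (F)

/-- `F^* ⊗ ℚ`, presented as the free `ℚ`-vector space on `F` modulo multiplicativity
(and modulo the generator at `0`). -/
def FSrel : Set (QF F) :=
  {z | ∃ x y : F, x ≠ 0 ∧ y ≠ 0 ∧
      z = Finsupp.single (x * y) 1 - Finsupp.single x 1 - Finsupp.single y 1} ∪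
    {Finsupp.single (0 : F) 1}

abbrev FS := QF F ⧸ Submodule.span ℚ (FSrel F)

/-- The class of `x ∈ F` in `F^* ⊗ ℚ`. -/
def fs (a : F) : FS F := (Submodule.span ℚ (FSrel F)).mkQ (Finsupp.single a 1)

variable {F}

/-- triple ratio of the configuration of six points of `P^2` obtained by projecting the
six points `z` of `P^3` from the centre `e`. -/
def tripleRatioFrom4 (e : Pt F 4) (z : Fin 6 → Pt F 4) : F :=
  (det4 e.rep (z 0).rep (z 1).rep (z 3).rep * det4 e.rep (z 1).rep (z 2).rep (z 4).rep *
      det4 e.rep (z 2).rep (z 0).rep (z 5).rep) /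
    (det4 e.rep (z 0).rep (z 1).rep (z 4).rep * det4 e.rep (z 1).rep (z 2).rep (z 5).rep *
      det4 e.rep (z 2).rep (z 0).rep (z 3).rep)

/-- `r_3` of the configuration of six points of `P^2` obtained by projection from `e ∈ P^3`. -/
def r3From4 (e : Pt F 4) (z : Fin 6 → Pt F 4) : QF F :=
  (1 / 15 : ℚ) • ∑ σ : Equiv.Perm (Fin 6), (Equiv.Perm.sign σ : ℤ) •
    gen (tripleRatioFrom4 e (z ∘ σ))

/-- `a_3'(l_0,...,l_3;m_0,...,m_3) = Σ_{i,j} (-1)^{i+j} r_3(l_i | l̂_i; m̂_j)`. -/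
def a3p (l m : Fin 4 → Pt F 4) : QF F :=
  ∑ i : Fin 4, ∑ j : Fin 4, ((-1 : ℤ) ^ ((i : ℕ) + (j : ℕ))) •
    r3From4 (l i) ![l (i.succAbove 0), l (i.succAbove 1), l (i.succAbove 2),
      m (j.succAbove 0), m (j.succAbove 1), m (j.succAbove 2)]

/-- `a_3''(l_0,...,l_3;m_0,...,m_3) = Σ_{i,j} (-1)^{i+j} μ_3(l_i,m_j | l̂_i; m̂_j)`,
the cross-ratios being taken after projection from the line through `l_i` and `m_j`. -/
def a3pp (l m : Fin 4 → Pt F 4) : QF F :=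
  ∑ i : Fin 4, ∑ j : Fin 4, ((-1 : ℤ) ^ ((i : ℕ) + (j : ℕ))) •
    mu3 (crLine (l i) (m j)) (l ∘ i.succAbove) (m ∘ j.succAbove)

/-- `a_3 = (1/6)·a_3' - (1/3)·a_3''` (at the level of `ℚ[F]`). -/
def a3free (l m : Fin 4 → Pt F 4) : QF F :=
  (1 / 6 : ℚ) • a3p l m - (1 / 3 : ℚ) • a3pp l m

/-- A pair of tetrahedra in `P^3` is in generic position when any four of the eight
vertices are projectively independent. -/
def GenericPair (l m : Fin 4 → Pt F 4) : Prop :=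
  ∀ a b c d : Fin 8, a ≠ b → a ≠ c → a ≠ d → b ≠ c → b ≠ d → c ≠ d →
    det4 ((Fin.append l m a).rep) ((Fin.append l m b).rep)
      ((Fin.append l m c).rep) ((Fin.append l m d).rep) ≠ 0

variable (F)

/-- `B_3(F) ⊗ F^*` (over `ℚ`). -/
abbrev T31 := B3 F ⊗[ℚ] FS F

/-- The exterior algebra of `B_2(F)`, housing `Λ² B_2(F)`. -/
abbrev LamB2 := ExteriorAlgebra ℚ (B2 F)

variable {F}

/-- wedge product. -/
def wedge {M : Type} [AddCommGroup M] [Module ℚ M] (a b : M) : ExteriorAlgebra ℚ M :=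
  ExteriorAlgebra.ι ℚ a * ExteriorAlgebra.ι ℚ b

/-- Eight points of `P^3` are in generic position when any four of them are projectively
independent. -/
def Generic8 (x : Fin 8 → Pt F 4) : Prop :=
  ∀ a b c d : Fin 8, a ≠ b → a ≠ c → a ≠ d → b ≠ c → b ≠ d → c ≠ d →
    det4 (x a).rep (x b).rep (x c).rep (x d).rep ≠ 0

/-- The `B_3(F) ⊗ F^*`-component of the degree four cobracket on a generator:
`(a_3 ⊗ id - id ⊗ a_3)` applied to `(δ_{3,1}(l_1,...,l_8), δ_{1,3}(l_1,...,l_8))`, i.e.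
`Alt_8( a_3(l_1,...,l_4;l_5,...,l_8) ⊗ (Δ(l_5,l_6,l_7,l_8) + Δ(l_1,l_2,l_3,l_4)) )`. -/
def phi31 (x : Fin 8 → Pt F 4) : T31 F :=
  ∑ σ : Equiv.Perm (Fin 8), (Equiv.Perm.sign σ : ℤ) •
    (clsB3 F (a3free (fun t : Fin 4 => x (σ (Fin.castAdd 4 t)))
        (fun t : Fin 4 => x (σ (Fin.natAdd 4 t)))) ⊗ₜ[ℚ]
      (fs F (det4 (x (σ (Fin.natAdd 4 (0 : Fin 4)))).rep (x (σ (Fin.natAdd 4 (1 : Fin 4)))).rep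
          (x (σ (Fin.natAdd 4 (2 : Fin 4)))).rep (x (σ (Fin.natAdd 4 (3 : Fin 4)))).rep) +
        fs F (det4 (x (σ (Fin.castAdd 4 (0 : Fin 4)))).rep (x (σ (Fin.castAdd 4 (1 : Fin 4)))).rep
          (x (σ (Fin.castAdd 4 (2 : Fin 4)))).rep (x (σ (Fin.castAdd 4 (3 : Fin 4)))).rep)))

/-- The `Λ² B_2(F)`-component `δ_{2,2}` of the degree four cobracket on a generator:
`(288/7)·Alt_8( (l_1,l_2|l_3,l_4,l_5,l_6)_2 ∧ (l_3,l_4|l_1,l_2,l_5,l_7)_2 )`. -/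
def phi22 (x : Fin 8 → Pt F 4) : LamB2 F :=
  (288 / 7 : ℚ) • ∑ σ : Equiv.Perm (Fin 8), (Equiv.Perm.sign σ : ℤ) •
    wedge (b2 F (crLine (x (σ 0)) (x (σ 1)) (x (σ 2)) (x (σ 3)) (x (σ 4)) (x (σ 5))))
      (b2 F (crLine (x (σ 2)) (x (σ 3)) (x (σ 0)) (x (σ 1)) (x (σ 4)) (x (σ 6))))

/-- The degree four cobracket `δ` on a generator of `G̃_4(F)`, with values in
`(B_3(F) ⊗ F^*) ⊕ Λ²B_2(F)`. -/
def phi (x : Fin 8 → Pt F 4) : T31 F × LamB2 F := (phi31 x, phi22 x)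

section Cobracket

open Equiv Equiv.Perm

section Alternation

variable {M : Type} [AddCommGroup M]

/-- The alternating sum of `f` over the symmetric group. -/
def alt {n : ℕ} (f : Perm (Fin n) → M) : M := ∑ σ : Perm (Fin n), (sign σ : ℤ) • f σ

lemma alt_mul_right {n : ℕ} (f : Perm (Fin n) → M) (π : Perm (Fin n)) :
    alt (fun σ => f (σ * π)) = (sign π : ℤ) • alt f := by
  unfold alt
  rw [← Equiv.sum_comp (Equiv.mulRight π) (fun σ => (sign σ : ℤ) • f σ), Finset.smul_sum]
  refine Finset.sum_congr rfl fun σ _ => ?_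
  have h : (sign π : ℤ) * (sign π : ℤ) = 1 := by
    rw [← Units.val_mul, Int.units_mul_self, Units.val_one]
  rw [Equiv.coe_mulRight, Perm.sign_mul, smul_smul, Units.val_mul, mul_left_comm, h, mul_one]

lemma alt_congr_mul {n : ℕ} {f g : Perm (Fin n) → M} (π : Perm (Fin n))
    (h : ∀ σ, f σ = g (σ * π)) : alt f = (sign π : ℤ) • alt g := by
  rw [← alt_mul_right]
  exact congrArg alt (funext h)

lemma alt_add {n : ℕ} (f g : Perm (Fin n) → M) :
    alt (fun σ => f σ + g σ) = alt f + alt g := by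
  simp [alt, Finset.sum_add_distrib]

lemma alt_sub {n : ℕ} (f g : Perm (Fin n) → M) :
    alt (fun σ => f σ - g σ) = alt f - alt g := by
  simp [alt, Finset.sum_sub_distrib, smul_sub]

lemma alt_neg {n : ℕ} (f : Perm (Fin n) → M) : alt (fun σ => -f σ) = -alt f := by
  simp [alt]

lemma alt_zero {n : ℕ} : alt (fun _ : Perm (Fin n) => (0 : M)) = 0 := by
  simp [alt]

lemma alt_zsmul {n : ℕ} (c : ℤ) (f : Perm (Fin n) → M) :
    alt (fun σ => c • f σ) = c • alt f := by
  simp only [alt, Finset.smul_sum]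
  exact Finset.sum_congr rfl fun σ _ => smul_comm _ _ _

lemma alt_sum {n : ℕ} {κ : Type} (s : Finset κ) (f : κ → Perm (Fin n) → M) :
    alt (fun σ => ∑ k ∈ s, f k σ) = ∑ k ∈ s, alt (f k) := by
  simp only [alt, Finset.smul_sum]
  exact Finset.sum_comm

variable [Module ℚ M]

lemma alt_qsmul {n : ℕ} (c : ℚ) (f : Perm (Fin n) → M) :
    alt (fun σ => c • f σ) = c • alt f := by
  simp only [alt, Finset.smul_sum]
  exact Finset.sum_congr rfl fun σ _ => smul_comm _ _ _

lemma eq_zero_of_eq_neg {a : M} (h : a = -a) : a = 0 := by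
  have h2 : (2 : ℚ) • a = 0 := by
    rw [two_smul]
    nth_rewrite 2 [h]
    exact add_neg_cancel a
  exact (smul_eq_zero.mp h2).resolve_left two_ne_zero

lemma alt_eq_zero_of_odd {n : ℕ} {f : Perm (Fin n) → M} (π : Perm (Fin n)) (hπ : sign π = -1)
    (h : ∀ σ, f σ = f (σ * π)) : alt f = 0 := by
  apply eq_zero_of_eq_neg
  conv_lhs => rw [alt_congr_mul π h, hπ]
  simp

lemma alt_eq_zero_of_swap {n : ℕ} {f : Perm (Fin n) → M} (i j : Fin n) (hij : i ≠ j)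
    (h : ∀ σ, f σ = f (σ * swap i j)) : alt f = 0 :=
  alt_eq_zero_of_odd (swap i j) (sign_swap hij) h

end Alternation

lemma sign_cycleRange_symm {n : ℕ} (i : Fin (n + 1)) :
    (sign i.cycleRange.symm : ℤ) = (-1) ^ (i : ℕ) := by
  rw [sign_symm, Fin.sign_cycleRange]
  simp

/-- The permutation of `{0, ..., n}` fixing `0` and permuting the rest by `σ`. -/
def extendPerm {n : ℕ} (σ : Perm (Fin n)) : Perm (Fin (n + 1)) := decomposeFin.symm (0, σ)

@[simp] lemma extendPerm_zero {n : ℕ} (σ : Perm (Fin n)) : extendPerm σ 0 = 0 := by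
  simp [extendPerm]

@[simp] lemma extendPerm_succ {n : ℕ} (σ : Perm (Fin n)) (k : Fin n) :
    extendPerm σ k.succ = (σ k).succ := by
  simp [extendPerm]

@[simp] lemma sign_extendPerm {n : ℕ} (σ : Perm (Fin n)) : sign (extendPerm σ) = sign σ := by
  simp [extendPerm]

/-- Alternating over all orderings of `n + 1` points amounts to deleting a point and
alternating over the remaining ones. -/
lemma sum_alt_succAbove {M : Type} [AddCommGroup M] {n : ℕ}
    (g : Fin (n + 1) → (Fin n → Fin (n + 1)) → M) :
    ∑ i : Fin (n + 1), ((-1 : ℤ) ^ (i : ℕ)) •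
        alt (fun σ : Perm (Fin n) => g i (fun k => i.succAbove (σ k))) =
      alt (fun τ : Perm (Fin (n + 1)) => g (τ 0) (fun k => τ k.succ)) := by
  have key : Function.Bijective
      (fun p : Fin (n + 1) × Perm (Fin n) => p.1.cycleRange.symm * extendPerm p.2) := by
    rw [Fintype.bijective_iff_injective_and_card]
    constructor
    · rintro ⟨i, σ⟩ ⟨j, τ⟩ h
      have hi : i = j := by simpa using congrArg (fun e : Perm (Fin (n + 1)) => e 0) h
      subst hi
      have h' : extendPerm σ = extendPerm τ := mul_left_cancel h
      have : σ = τ := by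
        ext k
        simpa using congrArg (fun e : Perm (Fin (n + 1)) => ((e k.succ : Fin (n + 1)) : ℕ)) h'
      rw [this]
    · simp [Fintype.card_perm, Nat.factorial_succ]
  unfold alt
  rw [← Fintype.sum_bijective _ key _ _ (fun _ => rfl), Fintype.sum_prod_type]
  refine Finset.sum_congr rfl fun i _ => ?_
  rw [Finset.smul_sum]
  refine Finset.sum_congr rfl fun σ _ => ?_
  rw [smul_smul, Perm.sign_mul, Units.val_mul, sign_cycleRange_symm, sign_extendPerm]
  simp [Perm.mul_apply, Fin.cycleRange_symm_succ]

section Determinants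

variable {ι : Type}

/-- Cross-ratio of four indices with respect to a function `d` of two indices. -/
def crQ (d : ι → ι → F) (a b c e : ι) : F := (d a c * d b e) / (d a e * d b c)

/-- Triple ratio of six indices with respect to a function `d` of three indices. -/
def tr3 (d : ι → ι → ι → F) (z : Fin 6 → ι) : F :=
  (d (z 0) (z 1) (z 3) * d (z 1) (z 2) (z 4) * d (z 2) (z 0) (z 5)) /
    (d (z 0) (z 1) (z 4) * d (z 1) (z 2) (z 5) * d (z 2) (z 0) (z 3))

/-- The generalized cross-ratio with respect to a function `d` of three indices. -/
def r3Q (d : ι → ι → ι → F) (z : Fin 6 → ι) : QF F :=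
  (1 / 15 : ℚ) • ∑ σ : Perm (Fin 6), (sign σ : ℤ) • gen (tr3 d (z ∘ σ))

/-- The part `a_3'` of `a_3` with respect to a function `D` of four indices. -/
def a3pQ (D : ι → ι → ι → ι → F) (l m : Fin 4 → ι) : QF F :=
  ∑ i : Fin 4, ∑ j : Fin 4, ((-1 : ℤ) ^ ((i : ℕ) + (j : ℕ))) •
    r3Q (D (l i)) ![l (i.succAbove 0), l (i.succAbove 1), l (i.succAbove 2),
      m (j.succAbove 0), m (j.succAbove 1), m (j.succAbove 2)]

/-- The part `a_3''` of `a_3` with respect to a function `D` of four indices. -/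
def a3ppQ (D : ι → ι → ι → ι → F) (l m : Fin 4 → ι) : QF F :=
  ∑ i : Fin 4, ∑ j : Fin 4, ((-1 : ℤ) ^ ((i : ℕ) + (j : ℕ))) •
    mu3 (crQ (D (l i) (m j))) (l ∘ i.succAbove) (m ∘ j.succAbove)

/-- The map `a_3` with respect to a function `D` of four indices. -/
def a3Q (D : ι → ι → ι → ι → F) (l m : Fin 4 → ι) : QF F :=
  (1 / 6 : ℚ) • a3pQ D l m - (1 / 3 : ℚ) • a3ppQ D l m

/-- The `B_3 ⊗ F^*`-component of the cobracket with respect to a function `D` of four indices. -/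
def phi31Q (D : ι → ι → ι → ι → F) (u : Fin 8 → ι) : T31 F :=
  alt fun σ => clsB3 F (a3Q D (fun t : Fin 4 => u (σ (Fin.castAdd 4 t)))
        (fun t : Fin 4 => u (σ (Fin.natAdd 4 t)))) ⊗ₜ[ℚ]
      (fs F (D (u (σ (Fin.natAdd 4 (0 : Fin 4)))) (u (σ (Fin.natAdd 4 (1 : Fin 4))))
          (u (σ (Fin.natAdd 4 (2 : Fin 4)))) (u (σ (Fin.natAdd 4 (3 : Fin 4))))) +
        fs F (D (u (σ (Fin.castAdd 4 (0 : Fin 4)))) (u (σ (Fin.castAdd 4 (1 : Fin 4))))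
          (u (σ (Fin.castAdd 4 (2 : Fin 4)))) (u (σ (Fin.castAdd 4 (3 : Fin 4))))))

/-- The `Λ² B_2`-component of the cobracket with respect to a function `D` of four indices. -/
def phi22Q (D : ι → ι → ι → ι → F) (u : Fin 8 → ι) : LamB2 F :=
  (288 / 7 : ℚ) • alt fun σ : Perm (Fin 8) =>
    wedge (b2 F (crQ (D (u (σ 0)) (u (σ 1))) (u (σ 2)) (u (σ 3)) (u (σ 4)) (u (σ 5))))
      (b2 F (crQ (D (u (σ 2)) (u (σ 3))) (u (σ 0)) (u (σ 1)) (u (σ 4)) (u (σ 6))))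

/-- The determinants of quadruples of points, computed from the chosen lifts. -/
def detPt (a b c d : Pt F 4) : F := det4 a.rep b.rep c.rep d.rep

lemma phi_eq (x : Fin 8 → Pt F 4) : phi x = (phi31Q detPt x, phi22Q detPt x) := rfl

/-- A function of `k` indices is a determinant function when it is, up to a factor, the
determinant of vectors attached to the indices. -/
def IsDet {k : ℕ} (d : (Fin k → ι) → F) : Prop :=
  ∃ (w : ι → Fin k → F) (κ : F), ∀ z, d z = κ * dt (fun i => w (z i))

lemma dt_perm {k : ℕ} (v : Fin k → Fin k → F) (p : Perm (Fin k)) :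
    dt (fun i => v (p i)) = ((sign p : ℤ) : F) * dt v := by
  exact Matrix.det_permute p (Matrix.of v)

lemma IsDet.perm {k : ℕ} {d : (Fin k → ι) → F} (h : IsDet d) (z : Fin k → ι)
    (p : Perm (Fin k)) : d (fun i => z (p i)) = ((sign p : ℤ) : F) * d z := by
  obtain ⟨w, κ, h⟩ := h
  rw [h, h, dt_perm (fun i => w (z i)) p, mul_left_comm]

lemma IsDet.swap {k : ℕ} {d : (Fin k → ι) → F} (h : IsDet d) (z : Fin k → ι)
    {i j : Fin k} (hij : i ≠ j) : d (fun t => z (Equiv.swap i j t)) = -d z := by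
  rw [h.perm, sign_swap hij]
  simp

lemma IsDet.comp {κ : Type} {k : ℕ} {d : (Fin k → ι) → F} (h : IsDet d) (f : κ → ι) :
    IsDet (fun z : Fin k → κ => d (fun i => f (z i))) := by
  obtain ⟨w, c, h⟩ := h
  exact ⟨fun a => w (f a), c, fun z => h _⟩

lemma dt_map {n : ℕ} (g : (Fin n → F) →ₗ[F] (Fin n → F)) (u : Fin n → Fin n → F) :
    dt (fun i => g (u i)) = LinearMap.det g * dt u := by
  have : Matrix.of (fun i => g (u i)) = Matrix.of u * (LinearMap.toMatrix' g).transpose := by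
    ext a b
    have := congrFun (LinearMap.toMatrix'_mulVec g (u a)) b
    simp only [Matrix.of_apply, Matrix.mul_apply, Matrix.transpose_apply]
    rw [← this]
    simp only [Matrix.mulVec, dotProduct]
    exact Finset.sum_congr rfl fun _ _ => mul_comm _ _
  unfold dt
  rw [this, Matrix.det_mul, Matrix.det_transpose, LinearMap.det_toMatrix', mul_comm]

/-- Projecting along `e` computes determinants involving `e`. -/
lemma exists_dt_proj {k : ℕ} (L : (Fin (k + 1) → F) →ₗ[F] (Fin k → F))
    (hL : Function.Surjective L) {e : Fin (k + 1) → F} (he : e ≠ 0) (hLe : L e = 0) :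
    ∃ κ : F, κ ≠ 0 ∧ ∀ v : Fin k → Fin (k + 1) → F,
      dt (fun i => L (v i)) = κ * dt (Fin.cons e v) := by
  obtain ⟨i, hi⟩ : ∃ i, e i ≠ 0 := by
    by_contra h
    push Not at h
    exact he (funext h)
  let φ : (Fin (k + 1) → F) →ₗ[F] F := (e i)⁻¹ • LinearMap.proj i
  have hφ : φ e = 1 := by simp [φ, hi]
  let g : (Fin (k + 1) → F) →ₗ[F] (Fin (k + 1) → F) :=
    LinearMap.pi (Fin.cons φ (fun j => (LinearMap.proj j).comp L))
  have g0 : ∀ v, g v 0 = φ v := fun v => rfl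
  have gs : ∀ v j, g v (Fin.succ j) = L v j := fun v j => rfl
  have hg : Function.Surjective g := by
    intro y
    obtain ⟨v, hv⟩ := hL (fun j => y j.succ)
    refine ⟨v + (y 0 - φ v) • e, ?_⟩
    funext j
    refine Fin.cases ?_ (fun j => ?_) j
    · rw [g0, map_add, map_smul, hφ]
      simp
    · rw [gs, map_add, map_smul, hLe, hv]
      simp
  have hdet : LinearMap.det g ≠ 0 := by
    have hu : IsUnit g := (LinearMap.isUnit_iff_range_eq_top g).2 (LinearMap.range_eq_top.2 hg)
    exact (hu.map LinearMap.det).ne_zero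
  refine ⟨LinearMap.det g, hdet, fun v => ?_⟩
  rw [← dt_map]
  unfold dt
  rw [Matrix.det_succ_row_zero, Fin.sum_univ_succ]
  have hz : ∀ j : Fin k, g e j.succ = 0 := fun j => by rw [gs, hLe]; rfl
  have h0 : g e 0 = 1 := hφ
  simp only [Matrix.of_apply, Fin.cons_zero, h0, hz]
  simp only [Fin.val_zero, pow_zero, one_mul, mul_zero, zero_mul, Finset.sum_const_zero, add_zero]
  congr 1

lemma exists_dt_cons {k : ℕ} (e : Fin (k + 1) → F) :
    ∃ (L : (Fin (k + 1) → F) →ₗ[F] (Fin k → F)) (κ : F), ∀ v : Fin k → Fin (k + 1) → F,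
      dt (Fin.cons e v) = κ * dt (fun i => L (v i)) := by
  by_cases he : e = 0
  · refine ⟨0, 0, fun v => ?_⟩
    rw [zero_mul]
    exact Matrix.det_eq_zero_of_row_eq_zero 0 (fun j => by simp [he])
  obtain ⟨i, hi⟩ : ∃ i, e i ≠ 0 := by
    by_contra h
    push Not at h
    exact he (funext h)
  let L : (Fin (k + 1) → F) →ₗ[F] (Fin k → F) :=
    LinearMap.pi fun j => LinearMap.proj (i.succAbove j) -
      (e (i.succAbove j) / e i) • LinearMap.proj i
  have hLa : ∀ v j, L v j = v (i.succAbove j) - e (i.succAbove j) / e i * v i :=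
    fun v j => rfl
  have hL : Function.Surjective L := by
    intro y
    refine ⟨i.insertNth (0 : F) y, ?_⟩
    funext j
    simp [hLa]
  have hLe : L e = 0 := by
    funext j
    rw [hLa, div_mul_cancel₀ _ hi]
    simp
  obtain ⟨κ, hκ, h⟩ := exists_dt_proj L hL he hLe
  exact ⟨L, κ⁻¹, fun v => by rw [h, inv_mul_cancel_left₀ hκ]⟩

lemma IsDet.cons {k : ℕ} {d : (Fin (k + 1) → ι) → F} (h : IsDet d) (c : ι) :
    IsDet (fun z : Fin k → ι => d (Fin.cons c z)) := by
  obtain ⟨w, κ, h⟩ := h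
  obtain ⟨L, μ, hL⟩ := exists_dt_cons (w c)
  refine ⟨fun a => L (w a), κ * μ, fun z => ?_⟩
  change d (Fin.cons c z) = κ * μ * dt (fun i => L (w (z i)))
  rw [h, mul_assoc, ← hL]
  congr 2
  funext i
  refine Fin.cases rfl (fun _ => rfl) i

end Determinants

section Duality

/-- Gale duality: complementary minors of a configuration of `m + n` vectors of `F^m` and of
the dual configuration in `F^n` agree up to sign and a common factor. -/
lemma exists_dual_config {m n : ℕ} (v : Fin (m + n) → Fin m → F)
    (h : dt (fun i => v (Fin.castAdd n i)) ≠ 0) :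
    ∃ (w : Fin (m + n) → Fin n → F) (κ : F), ∀ p : Perm (Fin (m + n)),
      dt (fun i => v (p (Fin.castAdd n i))) =
        ((sign p : ℤ) : F) * κ * dt (fun j => w (p (Fin.natAdd m j))) := by
  let e : Fin m ⊕ Fin n ≃ Fin (m + n) := finSumFinEquiv
  let V1 : Matrix (Fin m) (Fin m) F := Matrix.of fun i => v (Fin.castAdd n i)
  let V2 : Matrix (Fin n) (Fin m) F := Matrix.of fun i => v (Fin.natAdd m i)
  let P : Matrix (Fin m ⊕ Fin n) (Fin m ⊕ Fin n) F := Matrix.fromBlocks V1 0 V2 1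
  have hPv : ∀ a i, P a (Sum.inl i) = v (e a) i := by
    rintro (a | a) i <;> rfl
  have hP : P.det = V1.det := by simp [P]
  have hPu : IsUnit P.det := by
    rw [hP]
    exact isUnit_iff_ne_zero.mpr h
  have hQ : P⁻¹ * P = 1 := Matrix.nonsing_inv_mul P hPu
  let W : Fin m ⊕ Fin n → Fin n → F := fun a j => P⁻¹ (Sum.inr j) a
  refine ⟨fun a => W (e.symm a), P.det, fun p => ?_⟩
  let q : Perm (Fin m ⊕ Fin n) := e.symm.permCongr p
  have hq : ∀ a, e (q a) = p (e a) := fun a => by simp [q, Equiv.permCongr_apply]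
  let N : Matrix (Fin m ⊕ Fin n) (Fin m ⊕ Fin n) F :=
    Matrix.fromBlocks 1 (Matrix.of fun i => W (q (Sum.inl i))) 0
      (Matrix.of fun i => W (q (Sum.inr i)))
  have hNr : ∀ a j, N a (Sum.inr j) = W (q a) j := by
    rintro (a | a) j <;> rfl
  have hNl : ∀ a j, N a (Sum.inl j) = if a = Sum.inl j then 1 else 0 := by
    rintro (a | a) j
    · simp [N, Matrix.one_apply]
    · simp [N]
  let T : Matrix (Fin m) (Fin m) F := Matrix.of fun i j => v (p (Fin.castAdd n j)) i
  let U : Matrix (Fin n) (Fin m) F := Matrix.of fun i j => P (q (Sum.inl j)) (Sum.inr i)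
  have key : (P.submatrix q id).transpose * N = Matrix.fromBlocks T 0 U 1 := by
    ext b c
    rcases c with c | c
    · have : ((P.submatrix q id).transpose * N) b (Sum.inl c) = P (q (Sum.inl c)) b := by
        simp [Matrix.mul_apply, hNl]
      rw [this]
      rcases b with b | b
      · rw [hPv, hq]
        rfl
      · rfl
    · have : ((P.submatrix q id).transpose * N) b (Sum.inr c) = (P⁻¹ * P) (Sum.inr c) b := by
        simp only [Matrix.mul_apply, Matrix.transpose_apply, Matrix.submatrix_apply, hNr, id]
        exact (Equiv.sum_comp q (fun a => P a b * W a c)).trans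
          (Finset.sum_congr rfl fun _ _ => mul_comm _ _)
      rw [this, hQ]
      rcases b with b | b
      · rfl
      · simp [Matrix.one_apply, eq_comm]
  have hN : N.det = (Matrix.of fun i => W (q (Sum.inr i))).det := by
    simp only [N, Matrix.det_fromBlocks_zero₂₁, Matrix.det_one, one_mul]
  have hR : (Matrix.fromBlocks T 0 U (1 : Matrix (Fin n) (Fin n) F)).det = T.det := by
    rw [Matrix.det_fromBlocks_zero₁₂, Matrix.det_one, mul_one]
  have hdet := congrArg Matrix.det key
  rw [Matrix.det_mul, Matrix.det_transpose, Matrix.det_permute, hN, hR,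
    Equiv.Perm.sign_permCongr] at hdet
  have hT : T.det = dt (fun i => v (p (Fin.castAdd n i))) := Matrix.det_transpose _
  rw [← hT, ← hdet]
  congr 2

end Duality

section FunctionalEquations

variable {ι : Type}

lemma div_eq_div_of_mul {a b a' b' k : F} (hk : k ≠ 0) (ha : a' = k * a) (hb : b' = k * b) :
    a' / b' = a / b := by
  rw [ha, hb, mul_div_mul_left _ _ hk]

lemma tr3_congr {κ : Type} {d : ι → ι → ι → F} {d' : κ → κ → κ → F} {z : Fin 6 → ι}
    {z' : Fin 6 → κ} (k : F) (hk : k ≠ 0) (c : Fin 6 → F) (hc : ∀ i, c i ≠ 0)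
    (h : ∀ i j l, d' (z' i) (z' j) (z' l) = k * (c i * c j * c l) * d (z i) (z j) (z l)) :
    tr3 d' z' = tr3 d z := by
  have h0 : k ^ 3 * (c 0 ^ 2 * c 1 ^ 2 * c 2 ^ 2 * c 3 * c 4 * c 5) ≠ 0 := by
    simp [hk, hc]
  unfold tr3
  apply div_eq_div_of_mul h0 <;> simp only [h] <;> ring

lemma r3Q_congr {κ : Type} {d : ι → ι → ι → F} {d' : κ → κ → κ → F} {z : Fin 6 → ι}
    {z' : Fin 6 → κ} (k : F) (hk : k ≠ 0) (c : Fin 6 → F) (hc : ∀ i, c i ≠ 0)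
    (h : ∀ i j l, d' (z' i) (z' j) (z' l) = k * (c i * c j * c l) * d (z i) (z j) (z l)) :
    r3Q d' z' = r3Q d z := by
  unfold r3Q
  refine congrArg _ ?_
  refine Finset.sum_congr rfl fun σ _ => ?_
  rw [tr3_congr (z := z ∘ σ) (z' := z' ∘ σ) k hk (c ∘ σ) (fun i => hc _)
    (fun i j l => h (σ i) (σ j) (σ l))]

lemma crQ_congr {κ : Type} {d : ι → ι → F} {d' : κ → κ → F} {a b e f : ι} {a' b' e' f' : κ}
    (k ca cb ce cf : F) (hk : k ≠ 0) (ha : ca ≠ 0) (hb : cb ≠ 0) (he : ce ≠ 0) (hf : cf ≠ 0)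
    (h1 : d' a' e' = k * (ca * ce) * d a e) (h2 : d' b' f' = k * (cb * cf) * d b f)
    (h3 : d' a' f' = k * (ca * cf) * d a f) (h4 : d' b' e' = k * (cb * ce) * d b e) :
    crQ d' a' b' e' f' = crQ d a b e f := by
  have h0 : k ^ 2 * (ca * cb * ce * cf) ≠ 0 := by simp [hk, ha, hb, he, hf]
  unfold crQ
  apply div_eq_div_of_mul h0
  · rw [h1, h2]; ring
  · rw [h3, h4]; ring

lemma exists_rep_eq_smul {N : ℕ} (v : Fin N → F) (hv : v ≠ 0) :
    ∃ c : F, c ≠ 0 ∧ (Projectivization.mk F v hv).rep = c • v := by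
  obtain ⟨a, ha⟩ := Projectivization.exists_smul_eq_mk_rep F v hv
  exact ⟨a, a.ne_zero, ha.symm⟩

lemma dt_smul {k : ℕ} (c : Fin k → F) (v : Fin k → Fin k → F) :
    dt (fun i => c i • v i) = (∏ i, c i) * dt v :=
  Matrix.det_mul_column c (Matrix.of v)

lemma det3_smul (a b c : F) (x y z : Fin 3 → F) :
    det3 (a • x) (b • y) (c • z) = a * b * c * det3 x y z := by
  have h : (![a • x, b • y, c • z] : Fin 3 → Fin 3 → F) =
      fun i => (![a, b, c] : Fin 3 → F) i • (![x, y, z] : Fin 3 → Fin 3 → F) i := by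
    funext i
    fin_cases i <;> rfl
  rw [det3, h, dt_smul, Fin.prod_univ_three]
  rfl

lemma dt_eq_det3 {v : Fin 3 → Fin 3 → F} : dt v = det3 (v 0) (v 1) (v 2) := by
  unfold det3
  congr 1
  funext i
  fin_cases i <;> rfl

lemma dt_eq_pair {v : Fin 2 → Fin 2 → F} : dt v = dt ![v 0, v 1] := by
  congr 1
  funext i
  fin_cases i <;> rfl

lemma dt_pair_smul (a b : F) (x y : Fin 2 → F) :
    dt ![a • x, b • y] = a * b * dt ![x, y] := by
  have h : (![a • x, b • y] : Fin 2 → Fin 2 → F) =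
      fun i => (![a, b] : Fin 2 → F) i • (![x, y] : Fin 2 → Fin 2 → F) i := by
    funext i
    fin_cases i <;> rfl
  rw [h, dt_smul, Fin.prod_univ_two]
  rfl

/-- The seven-term relation for seven vectors of `F^3`. -/
lemma seven_term {d : ι → ι → ι → F} (hd : IsDet fun z : Fin 3 → ι => d (z 0) (z 1) (z 2))
    (y : Fin 7 → ι) (hy : ∀ i j k : Fin 7, i ≠ j → i ≠ k → j ≠ k → d (y i) (y j) (y k) ≠ 0) :
    ∑ i : Fin 7, ((-1 : ℤ) ^ (i : ℕ)) • clsB3 F (r3Q d (y ∘ i.succAbove)) = 0 := by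
  obtain ⟨w, κ, hw⟩ := hd
  have hw' : ∀ a b c, d a b c = κ * det3 (w a) (w b) (w c) := fun a b c => by
    have := hw ![a, b, c]
    rwa [dt_eq_det3] at this
  have hκ : κ ≠ 0 := by
    rintro rfl
    exact hy 0 1 2 (by decide) (by decide) (by decide) (by rw [hw', zero_mul])
  have hne : ∀ i, w (y i) ≠ 0 := by
    intro i h
    have h2 : ∀ i : Fin 7, ∃ j k : Fin 7, i ≠ j ∧ i ≠ k ∧ j ≠ k := by decide
    obtain ⟨j, k, hij, hik, hjk⟩ := h2 i
    apply hy i j k hij hik hjk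
    rw [hw', h, det3, dt, Matrix.det_eq_zero_of_row_eq_zero 0 (fun j => rfl), mul_zero]
  choose c hc hrep using fun i => exists_rep_eq_smul (w (y i)) (hne i)
  let X : Fin 7 → Pt F 3 := fun i => Projectivization.mk F (w (y i)) (hne i)
  have hX : ∀ i j k, det3 (X i).rep (X j).rep (X k).rep =
      κ⁻¹ * (c i * c j * c k) * d (y i) (y j) (y k) := by
    intro i j k
    rw [hw', hrep, hrep, hrep, det3_smul]
    field_simp
  have hmem : ∑ i : Fin 7, ((-1 : ℤ) ^ (i : ℕ)) • r3free (X ∘ i.succAbove) ∈ R3 F := by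
    apply Submodule.subset_span
    refine Or.inl (Or.inr ⟨X, fun i j k hij hik hjk => ?_, rfl⟩)
    rw [hX]
    simp [hκ, hc, hy i j k hij hik hjk]
  have hzero : clsB3 F (∑ i : Fin 7, ((-1 : ℤ) ^ (i : ℕ)) • r3free (X ∘ i.succAbove)) = 0 :=
    (Submodule.Quotient.mk_eq_zero _).2 hmem
  rw [map_sum] at hzero
  rw [← hzero]
  refine Finset.sum_congr rfl fun i _ => ?_
  have h3 : r3free (X ∘ i.succAbove) = r3Q d (y ∘ i.succAbove) :=
    r3Q_congr (d' := fun a b c : Pt F 3 => det3 a.rep b.rep c.rep) κ⁻¹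
      (inv_ne_zero hκ) (c ∘ i.succAbove) (fun _ => hc _) (fun a b e => hX _ _ _)
  rw [map_zsmul, h3]

lemma clsB3_gen_inv (x : F) : clsB3 F (gen x⁻¹) = clsB3 F (gen x) := by
  have h : clsB3 F (gen x - gen x⁻¹) = 0 := by
    apply (Submodule.Quotient.mk_eq_zero _).2
    exact Submodule.subset_span (Or.inl (Or.inl ⟨x, rfl⟩))
  rw [map_sub, sub_eq_zero] at h
  exact h.symm

lemma exists_perm_natAdd {m n : ℕ} (f : Fin n → Fin (m + n)) (hf : Function.Injective f) :
    ∃ p : Perm (Fin (m + n)), ∀ t, p (Fin.natAdd m t) = f t := by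
  have hg : Function.Injective (Fin.natAdd m : Fin n → Fin (m + n)) := Fin.natAdd_injective n m
  let e : {x // x ∈ Set.range (Fin.natAdd m : Fin n → Fin (m + n))} ≃ {x // x ∈ Set.range f} :=
    (Equiv.ofInjective _ hg).symm.trans (Equiv.ofInjective f hf)
  refine ⟨e.extendSubtype, fun t => ?_⟩
  rw [e.extendSubtype_apply_of_mem _ ⟨t, rfl⟩]
  have : (⟨Fin.natAdd m t, ⟨t, rfl⟩⟩ : {x // x ∈ Set.range (Fin.natAdd m : Fin n → _)}) =
      Equiv.ofInjective _ hg t := rfl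
  simp only [e, Equiv.trans_apply]
  rw [this, Equiv.symm_apply_apply]
  rfl

/-- The permutation exchanging the two halves of `{0, ..., 5}`. -/
def halfSwap : Perm (Fin 6) := swap 0 3 * swap 1 4 * swap 2 5

lemma sign_halfSwap : sign halfSwap = -1 := by
  simp only [halfSwap, Perm.sign_mul]
  rw [sign_swap (by decide), sign_swap (by decide), sign_swap (by decide)]
  rfl

/-- The dual seven-term relation, for seven vectors of `F^4`. -/
lemma dual_seven_term {D : ι → ι → ι → ι → F}
    (hD : IsDet fun z : Fin 4 → ι => D (z 0) (z 1) (z 2) (z 3)) (y : Fin 7 → ι)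
    (hy : ∀ i j k l : Fin 7, i ≠ j → i ≠ k → i ≠ l → j ≠ k → j ≠ l → k ≠ l →
      D (y i) (y j) (y k) (y l) ≠ 0) :
    ∑ i : Fin 7, ((-1 : ℤ) ^ (i : ℕ)) • clsB3 F (r3Q (D (y i)) (y ∘ i.succAbove)) = 0 := by
  obtain ⟨v, κ, hv⟩ := hD
  have h0 : D (y 0) (y 1) (y 2) (y 3) ≠ 0 :=
    hy 0 1 2 3 (by decide) (by decide) (by decide) (by decide) (by decide) (by decide)
  have hv0 : dt (fun i : Fin 4 => v (y (Fin.castAdd 3 i))) ≠ 0 := by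
    intro h
    apply h0
    have := hv (fun i : Fin 4 => y (Fin.castAdd 3 i))
    rw [h, mul_zero] at this
    exact this
  obtain ⟨w, μ, hw⟩ := exists_dual_config (m := 4) (n := 3) (fun i => v (y i)) hv0
  let δ : Fin 7 → Fin 7 → Fin 7 → F := fun a b c => det3 (w a) (w b) (w c)
  have hδ : IsDet fun z : Fin 3 → Fin 7 => δ (z 0) (z 1) (z 2) :=
    ⟨w, 1, fun z => by rw [dt_eq_det3, one_mul]⟩
  have key : ∀ p : Perm (Fin 7), D (y (p 0)) (y (p 1)) (y (p 2)) (y (p 3)) =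
      ((sign p : ℤ) : F) * (κ * μ) * δ (p 4) (p 5) (p 6) := by
    intro p
    have h1 := hv (fun i : Fin 4 => y (p (Fin.castAdd 3 i)))
    have h2 := hw p
    rw [dt_eq_det3] at h2
    change D (y (p 0)) (y (p 1)) (y (p 2)) (y (p 3)) = _ at h1
    rw [h1, h2]
    change κ * (_ * μ * δ (p 4) (p 5) (p 6)) = _
    ring
  have hκμ : κ * μ ≠ 0 := by
    intro h
    have := key 1
    rw [h, mul_zero, zero_mul] at this
    exact h0 this
  have hgen : ∀ i j k : Fin 7, i ≠ j → i ≠ k → j ≠ k → δ i j k ≠ 0 := by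
    intro i j k hij hik hjk h
    obtain ⟨p, hp⟩ := exists_perm_natAdd (m := 4) (n := 3) (![i, j, k] : Fin 3 → Fin 7) (by
      intro a b hab
      fin_cases a <;> fin_cases b <;>
        first
          | rfl
          | exact absurd hab hij
          | exact absurd hab hik
          | exact absurd hab hjk
          | exact absurd hab.symm hij
          | exact absurd hab.symm hik
          | exact absurd hab.symm hjk)
    have h4 : p 4 = i := hp 0
    have h5 : p 5 = j := hp 1
    have h6 : p 6 = k := hp 2
    have := key p
    rw [h4, h5, h6, h, mul_zero] at this
    refine hy (p 0) (p 1) (p 2) (p 3) ?_ ?_ ?_ ?_ ?_ ?_ this <;>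
      exact fun h => absurd (p.injective h) (by decide)
  have htr : ∀ (i : Fin 7) (σ : Perm (Fin 6)),
      tr3 (D (y i)) ((y ∘ i.succAbove) ∘ σ) =
        (tr3 δ (i.succAbove ∘ (σ * halfSwap : Perm (Fin 6))))⁻¹ := by
    intro i σ
    let e : Perm (Fin 7) := i.cycleRange.symm * extendPerm σ
    have e0 : e 0 = i := by simp [e]
    have es : ∀ k, i.succAbove (σ k) = e k.succ := fun k => by simp [e]
    have key' : ∀ π : Perm (Fin 7), sign π = -1 →
        D (y (e (π 0))) (y (e (π 1))) (y (e (π 2))) (y (e (π 3))) =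
          (-((sign e : ℤ) : F) * (κ * μ)) * δ (e (π 4)) (e (π 5)) (e (π 6)) := by
      intro π hπ
      have := key (e * π)
      rw [Perm.sign_mul, hπ] at this
      simpa using this
    have hc : -((sign e : ℤ) : F) * (κ * μ) ≠ 0 := by
      refine mul_ne_zero (neg_ne_zero.mpr ?_) hκμ
      rcases Int.units_eq_one_or (sign e) with h | h <;> simp [h]
    have n1 := key' (swap 3 4 * swap 4 5 * swap 5 6) (by decide)
    have n2 := key' (swap 1 2 * swap 2 3 * swap 3 5 * swap 5 4 * swap 4 6) (by decide)
    have n3 := key' (swap 1 3 * swap 3 6 * swap 6 2) (by decide)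
    have d1 := key' (swap 3 5 * swap 5 4 * swap 4 6) (by decide)
    have d2 := key' (swap 1 2 * swap 2 3 * swap 3 6) (by decide)
    have d3 := key' (swap 1 3 * swap 3 4 * swap 4 5 * swap 5 6 * swap 6 2) (by decide)
    change D (y (e 0)) (y (e 1)) (y (e 2)) (y (e 4)) = _ * δ (e 5) (e 6) (e 3) at n1
    change D (y (e 0)) (y (e 2)) (y (e 3)) (y (e 5)) = _ * δ (e 6) (e 4) (e 1) at n2
    change D (y (e 0)) (y (e 3)) (y (e 1)) (y (e 6)) = _ * δ (e 4) (e 5) (e 2) at n3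
    change D (y (e 0)) (y (e 1)) (y (e 2)) (y (e 5)) = _ * δ (e 6) (e 4) (e 3) at d1
    change D (y (e 0)) (y (e 2)) (y (e 3)) (y (e 6)) = _ * δ (e 4) (e 5) (e 1) at d2
    change D (y (e 0)) (y (e 3)) (y (e 1)) (y (e 4)) = _ * δ (e 5) (e 6) (e 2) at d3
    have hR : tr3 δ (i.succAbove ∘ (σ * halfSwap : Perm (Fin 6))) =
        (δ (e 4) (e 5) (e 1) * δ (e 5) (e 6) (e 2) * δ (e 6) (e 4) (e 3)) /
          (δ (e 4) (e 5) (e 2) * δ (e 5) (e 6) (e 3) * δ (e 6) (e 4) (e 1)) := by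
      unfold tr3
      simp only [Function.comp_apply, Perm.mul_apply, es]
      rfl
    have hL : tr3 (D (y i)) ((y ∘ i.succAbove) ∘ σ) =
        (D (y (e 0)) (y (e 1)) (y (e 2)) (y (e 4)) * D (y (e 0)) (y (e 2)) (y (e 3)) (y (e 5)) *
          D (y (e 0)) (y (e 3)) (y (e 1)) (y (e 6))) /
        (D (y (e 0)) (y (e 1)) (y (e 2)) (y (e 5)) * D (y (e 0)) (y (e 2)) (y (e 3)) (y (e 6)) *
          D (y (e 0)) (y (e 3)) (y (e 1)) (y (e 4))) := by
      unfold tr3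
      simp only [Function.comp_apply, es, e0]
      rfl
    rw [hR, hL, n1, n2, n3, d1, d2, d3, inv_div]
    generalize -((sign e : ℤ) : F) * (κ * μ) = c at hc ⊢
    apply div_eq_div_of_mul (pow_ne_zero 3 hc) <;> ring
  have hterm : ∀ i : Fin 7, clsB3 F (r3Q (D (y i)) (y ∘ i.succAbove)) =
      -clsB3 F (r3Q δ (id ∘ i.succAbove)) := by
    intro i
    have h1 : ∀ d : Fin 7 → Fin 7 → Fin 7 → F, ∑ σ : Perm (Fin 6),
        (sign σ : ℤ) • clsB3 F (gen (tr3 d (i.succAbove ∘ (σ * halfSwap : Perm (Fin 6))))) =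
        -∑ σ : Perm (Fin 6), (sign σ : ℤ) • clsB3 F (gen (tr3 d (i.succAbove ∘ σ))) := by
      intro d
      have := alt_mul_right
        (fun σ : Perm (Fin 6) => clsB3 F (gen (tr3 d (i.succAbove ∘ σ)))) halfSwap
      rw [sign_halfSwap] at this
      simpa [alt] using this
    unfold r3Q
    simp only [map_smul, map_sum, map_zsmul, htr, clsB3_gen_inv, h1, smul_neg]
    rfl
  simp only [hterm, smul_neg, Finset.sum_neg_distrib]
  rw [seven_term hδ id hgen, neg_zero]

end FunctionalEquations

section FiveTerm

variable {ι : Type}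

lemma mk_injective_of_dt {n : ℕ} {v : Fin n → Fin 2 → F} (hv : ∀ i, v i ≠ 0)
    (h : ∀ i j, i ≠ j → dt ![v i, v j] ≠ 0) :
    Function.Injective fun i => (Projectivization.mk F (v i) (hv i) : Pt F 2) := by
  intro i j hij
  by_contra hne
  obtain ⟨a, ha⟩ := (Projectivization.mk_eq_mk_iff' F _ _ (hv i) (hv j)).1 hij
  apply h i j hne
  rw [← ha]
  simp only [dt, Matrix.det_fin_two, Matrix.of_apply, Matrix.cons_val_zero, Matrix.cons_val_one,
    Pi.smul_apply, smul_eq_mul]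
  ring

/-- The five-term relation for five vectors of `F^2`. -/
lemma five_term {d : ι → ι → F} (hd : IsDet fun z : Fin 2 → ι => d (z 0) (z 1))
    (y : Fin 5 → ι) (hy : ∀ i j : Fin 5, i ≠ j → d (y i) (y j) ≠ 0) :
    ∑ i : Fin 5, ((-1 : ℤ) ^ (i : ℕ)) • b2 F (crQ d (y (i.succAbove 0)) (y (i.succAbove 1))
      (y (i.succAbove 2)) (y (i.succAbove 3))) = 0 := by
  obtain ⟨w, κ, hw⟩ := hd
  have hw' : ∀ a b, d a b = κ * dt ![w a, w b] := fun a b => by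
    have := hw ![a, b]
    rwa [dt_eq_pair] at this
  have hκ : κ ≠ 0 := by
    rintro rfl
    exact hy 0 1 (by decide) (by rw [hw', zero_mul])
  have hne : ∀ i, w (y i) ≠ 0 := by
    intro i h
    have h2 : ∀ i : Fin 5, ∃ j : Fin 5, i ≠ j := by decide
    obtain ⟨j, hij⟩ := h2 i
    apply hy i j hij
    rw [hw', h, dt, Matrix.det_eq_zero_of_row_eq_zero 0 (fun j => rfl), mul_zero]
  choose c hc hrep using fun i => exists_rep_eq_smul (w (y i)) (hne i)
  let X : Fin 5 → Pt F 2 := fun i => Projectivization.mk F (w (y i)) (hne i)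
  have hX : ∀ i j, dt ![(X i).rep, (X j).rep] = κ⁻¹ * (c i * c j) * d (y i) (y j) := by
    intro i j
    rw [hw', hrep, hrep, dt_pair_smul]
    field_simp
  have hmem : fiveTerm X ∈ R2 F := by
    apply Submodule.subset_span
    refine Or.inl ⟨X, mk_injective_of_dt hne fun i j hij h => hy i j hij ?_, rfl⟩
    rw [hw', h, mul_zero]
  have hzero : clsB2 F (fiveTerm X) = 0 := (Submodule.Quotient.mk_eq_zero _).2 hmem
  unfold fiveTerm at hzero
  rw [map_sum] at hzero
  rw [← hzero]
  refine Finset.sum_congr rfl fun i _ => ?_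
  have h3 : cr1 (X (i.succAbove 0)) (X (i.succAbove 1)) (X (i.succAbove 2))
      (X (i.succAbove 3)) = crQ d (y (i.succAbove 0)) (y (i.succAbove 1))
      (y (i.succAbove 2)) (y (i.succAbove 3)) :=
    crQ_congr (d' := fun a b : Pt F 2 => dt ![a.rep, b.rep]) κ⁻¹ _ _ _ _
      (inv_ne_zero hκ) (hc _) (hc _) (hc _) (hc _) (hX _ _) (hX _ _) (hX _ _) (hX _ _)
  rw [map_zsmul, h3]
  rfl

/-- The dual five-term relation, for five vectors of `F^3`. -/
lemma dual_five_term {D : ι → ι → ι → F}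
    (hD : IsDet fun z : Fin 3 → ι => D (z 0) (z 1) (z 2)) (y : Fin 5 → ι)
    (hy : ∀ i j k : Fin 5, i ≠ j → i ≠ k → j ≠ k → D (y i) (y j) (y k) ≠ 0) :
    ∑ i : Fin 5, ((-1 : ℤ) ^ (i : ℕ)) • b2 F (crQ (D (y i)) (y (i.succAbove 0))
      (y (i.succAbove 1)) (y (i.succAbove 2)) (y (i.succAbove 3))) = 0 := by
  obtain ⟨v, κ, hv⟩ := hD
  have h0 : D (y 0) (y 1) (y 2) ≠ 0 := hy 0 1 2 (by decide) (by decide) (by decide)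
  have hv0 : dt (fun i : Fin 3 => v (y (Fin.castAdd 2 i))) ≠ 0 := by
    intro h
    apply h0
    have := hv (fun i : Fin 3 => y (Fin.castAdd 2 i))
    rw [h, mul_zero] at this
    exact this
  obtain ⟨w, μ, hw⟩ := exists_dual_config (m := 3) (n := 2) (fun i => v (y i)) hv0
  let δ : Fin 5 → Fin 5 → F := fun a b => dt ![w a, w b]
  have hδ : IsDet fun z : Fin 2 → Fin 5 => δ (z 0) (z 1) :=
    ⟨w, 1, fun z => by rw [dt_eq_pair, one_mul]⟩
  have key : ∀ p : Perm (Fin 5), D (y (p 0)) (y (p 1)) (y (p 2)) =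
      ((sign p : ℤ) : F) * (κ * μ) * δ (p 3) (p 4) := by
    intro p
    have h1 := hv (fun i : Fin 3 => y (p (Fin.castAdd 2 i)))
    have h2 := hw p
    rw [dt_eq_pair] at h2
    change D (y (p 0)) (y (p 1)) (y (p 2)) = _ at h1
    rw [h1, h2]
    change κ * (_ * μ * δ (p 3) (p 4)) = _
    ring
  have hκμ : κ * μ ≠ 0 := by
    intro h
    have := key 1
    rw [h, mul_zero, zero_mul] at this
    exact h0 this
  have hgen : ∀ i j : Fin 5, i ≠ j → δ i j ≠ 0 := by
    intro i j hij h
    obtain ⟨p, hp⟩ := exists_perm_natAdd (m := 3) (n := 2) (![i, j] : Fin 2 → Fin 5) (by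
      intro a b hab
      fin_cases a <;> fin_cases b <;>
        first
          | rfl
          | exact absurd hab hij
          | exact absurd hab.symm hij)
    have h3 : p 3 = i := hp 0
    have h4 : p 4 = j := hp 1
    have := key p
    rw [h3, h4, h, mul_zero] at this
    refine hy (p 0) (p 1) (p 2) ?_ ?_ ?_ this <;>
      exact fun h => absurd (p.injective h) (by decide)
  have hterm : ∀ i : Fin 5, crQ (D (y i)) (y (i.succAbove 0)) (y (i.succAbove 1))
      (y (i.succAbove 2)) (y (i.succAbove 3)) = crQ δ (id (i.succAbove 0)) (id (i.succAbove 1))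
      (id (i.succAbove 2)) (id (i.succAbove 3)) := by
    intro i
    let e : Perm (Fin 5) := i.cycleRange.symm * extendPerm 1
    have e0 : e 0 = i := by simp [e]
    have es : ∀ k, i.succAbove k = e k.succ := fun k => by simp [e]
    have hc : ((sign e : ℤ) : F) * (κ * μ) ≠ 0 := by
      refine mul_ne_zero ?_ hκμ
      rcases Int.units_eq_one_or (sign e) with h | h <;> simp [h]
    have key' : ∀ (π : Perm (Fin 5)) (s : ℤˣ), sign π = s →
        D (y (e (π 0))) (y (e (π 1))) (y (e (π 2))) =
          ((s : ℤ) : F) * (((sign e : ℤ) : F) * (κ * μ)) * δ (e (π 3)) (e (π 4)) := by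
      intro π s hπ
      have := key (e * π)
      rw [Perm.sign_mul, hπ] at this
      simp only [Perm.mul_apply] at this
      rw [this]
      push_cast
      ring
    have n1 := key' (swap 2 3) (-1) (by decide)
    have n2 := key' (swap 1 2 * swap 2 4 * swap 4 3) (-1) (by decide)
    have d1 := key' (swap 2 4 * swap 4 3) 1 (by decide)
    have d2 := key' (swap 1 2 * swap 2 3) 1 (by decide)
    change D (y (e 0)) (y (e 1)) (y (e 3)) = _ * δ (e 2) (e 4) at n1
    change D (y (e 0)) (y (e 2)) (y (e 4)) = _ * δ (e 1) (e 3) at n2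
    change D (y (e 0)) (y (e 1)) (y (e 4)) = _ * δ (e 2) (e 3) at d1
    change D (y (e 0)) (y (e 2)) (y (e 3)) = _ * δ (e 1) (e 4) at d2
    have hR : crQ δ (id (i.succAbove 0)) (id (i.succAbove 1)) (id (i.succAbove 2))
        (id (i.succAbove 3)) = (δ (e 1) (e 3) * δ (e 2) (e 4)) /
          (δ (e 1) (e 4) * δ (e 2) (e 3)) := by
      unfold crQ
      simp only [id, es]
      rfl
    have hL : crQ (D (y i)) (y (i.succAbove 0)) (y (i.succAbove 1)) (y (i.succAbove 2))
        (y (i.succAbove 3)) = (D (y (e 0)) (y (e 1)) (y (e 3)) * D (y (e 0)) (y (e 2)) (y (e 4))) /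
          (D (y (e 0)) (y (e 1)) (y (e 4)) * D (y (e 0)) (y (e 2)) (y (e 3))) := by
      unfold crQ
      simp only [es, e0]
      rfl
    rw [hR, hL, n1, n2, d1, d2]
    generalize ((sign e : ℤ) : F) * (κ * μ) = c at hc ⊢
    apply div_eq_div_of_mul (pow_ne_zero 2 hc) <;> push_cast <;> ring
  simp only [hterm]
  exact five_term hδ id hgen

end FiveTerm

section Vanishing22

lemma wedge_comm_neg {M : Type} [AddCommGroup M] [Module ℚ M] (a b : M) :
    wedge a b = -wedge b a :=
  eq_neg_of_add_eq_zero_left (ExteriorAlgebra.ι_add_mul_swap a b)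

variable {ι : Type}

/-- The `9`-term relation for `δ_{2,2}`. -/
lemma phi22_nine_term (D : ι → ι → ι → ι → F) (u : Fin 9 → ι) :
    alt (fun τ : Perm (Fin 9) =>
      wedge (b2 F (crQ (D (u (τ 1)) (u (τ 2))) (u (τ 3)) (u (τ 4)) (u (τ 5)) (u (τ 6))))
        (b2 F (crQ (D (u (τ 3)) (u (τ 4))) (u (τ 1)) (u (τ 2)) (u (τ 5)) (u (τ 7))))) = 0 :=
  alt_eq_zero_of_swap 0 8 (by decide) fun _ => rfl

/-- The dual `9`-term relation for `δ_{2,2}`. -/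
lemma phi22_dual_nine_term (G : Fin 9 → Fin 9 → Fin 9 → Fin 9 → Fin 9 → F)
    (hG : IsDet fun z : Fin 5 → Fin 9 => G (z 0) (z 1) (z 2) (z 3) (z 4))
    (hne : ∀ z : Fin 5 → Fin 9, Function.Injective z →
      G (z 0) (z 1) (z 2) (z 3) (z 4) ≠ 0) :
    alt (fun τ : Perm (Fin 9) =>
      wedge (b2 F (crQ (G (τ 0) (τ 1) (τ 2)) (τ 3) (τ 4) (τ 5) (τ 6)))
        (b2 F (crQ (G (τ 0) (τ 3) (τ 4)) (τ 1) (τ 2) (τ 5) (τ 7)))) = 0 := by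
  let S : (Fin 7 → Fin 9) → B2 F := fun z =>
    b2 F (crQ (G (z 0) (z 1) (z 2)) (z 3) (z 4) (z 5) (z 6))
  let A : (Fin 7 → Fin 9) → (Fin 7 → Fin 9) → LamB2 F := fun p q =>
    alt fun τ : Perm (Fin 9) => wedge (S (τ ∘ p)) (S (τ ∘ q))
  have G01 : ∀ a b c d e, G b a c d e = -G a b c d e := fun a b c d e =>
    hG.swap ![a, b, c, d, e] (show (0 : Fin 5) ≠ 1 by decide)
  have G12 : ∀ a b c d e, G a c b d e = -G a b c d e := fun a b c d e =>
    hG.swap ![a, b, c, d, e] (show (1 : Fin 5) ≠ 2 by decide)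
  have cr_neg : ∀ (d d' : Fin 9 → Fin 9 → F), (∀ x y, d' x y = -d x y) →
      ∀ a b c e, crQ d' a b c e = crQ d a b c e := fun d d' h a b c e => by
    simp only [crQ, h, neg_mul_neg]
  have S01 : ∀ (τ : Perm (Fin 9)) (a b c d e f g : Fin 9),
      S (τ ∘ ![b, a, c, d, e, f, g]) = S (τ ∘ ![a, b, c, d, e, f, g]) :=
    fun τ a b c d e f g => congrArg (b2 F) (cr_neg _ _ (fun _ _ => G01 _ _ _ _ _) _ _ _ _)
  have S12 : ∀ (τ : Perm (Fin 9)) (a b c d e f g : Fin 9),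
      S (τ ∘ ![a, c, b, d, e, f, g]) = S (τ ∘ ![a, b, c, d, e, f, g]) :=
    fun τ a b c d e f g => congrArg (b2 F) (cr_neg _ _ (fun _ _ => G12 _ _ _ _ _) _ _ _ _)
  have A01l : ∀ (a b c d e f g : Fin 9) q,
      A ![b, a, c, d, e, f, g] q = A ![a, b, c, d, e, f, g] q := fun a b c d e f g q => by
    simp only [A, S01 _ a b]
  have A12l : ∀ (a b c d e f g : Fin 9) q,
      A ![a, c, b, d, e, f, g] q = A ![a, b, c, d, e, f, g] q := fun a b c d e f g q => by
    simp only [A, S12 _ a b]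
  have A01r : ∀ (a b c d e f g : Fin 9) q,
      A q ![b, a, c, d, e, f, g] = A q ![a, b, c, d, e, f, g] := fun a b c d e f g q => by
    simp only [A, S01 _ a b]
  have A12r : ∀ (a b c d e f g : Fin 9) q,
      A q ![a, c, b, d, e, f, g] = A q ![a, b, c, d, e, f, g] := fun a b c d e f g q => by
    simp only [A, S12 _ a b]
  have A_anti : ∀ p q, A p q = -A q p := fun p q => by
    simp only [A]
    rw [← alt_neg]
    exact congrArg alt (funext fun τ => wedge_comm_neg _ _)
  have A_perm : ∀ (ρ : Perm (Fin 9)) (p q p' q' : Fin 7 → Fin 9), ρ ∘ p = p' → ρ ∘ q = q' →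
      A p' q' = (sign ρ : ℤ) • A p q := by
    rintro ρ p q _ _ rfl rfl
    exact alt_congr_mul ρ fun τ => rfl
  have three : ∀ a : LamB2 F, a + a + a = 0 → a = 0 := fun a h => by
    have h3 : (3 : ℚ) • a = 0 := by
      rw [← h, show (3 : ℚ) = 1 + 1 + 1 by norm_num, add_smul, add_smul, one_smul]
    exact (smul_eq_zero.mp h3).resolve_left (by norm_num)
  let c3 : Perm (Fin 9) := swap 0 1 * swap 1 2
  have sc3 : sign c3 = 1 := by decide
  have s01 : sign (swap 0 1 : Perm (Fin 9)) = -1 := by decide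
  have t4 : A ![0, 1, 2, 3, 4, 5, 6] ![3, 4, 5, 0, 1, 2, 6] = 0 := by
    apply eq_zero_of_eq_neg
    have := A_perm (swap 7 8) ![0, 1, 2, 3, 4, 5, 6] ![3, 4, 5, 0, 1, 2, 6]
      ![0, 1, 2, 3, 4, 5, 6] ![3, 4, 5, 0, 1, 2, 6] (by decide) (by decide)
    rwa [show sign (swap 7 8 : Perm (Fin 9)) = -1 by decide, Units.val_neg, Units.val_one,
      neg_one_smul] at this
  have t3 : A ![0, 1, 2, 3, 4, 5, 6] ![3, 4, 5, 0, 1, 2, 7] = 0 := by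
    apply eq_zero_of_eq_neg
    have := A_perm (swap 0 3 * swap 1 4 * swap 2 5 * swap 6 7) ![0, 1, 2, 3, 4, 5, 6]
      ![3, 4, 5, 0, 1, 2, 7] ![3, 4, 5, 0, 1, 2, 7] ![0, 1, 2, 3, 4, 5, 6] (by decide) (by decide)
    rw [show sign (swap 0 3 * swap 1 4 * swap 2 5 * swap 6 7 : Perm (Fin 9)) = 1 by decide,
      Units.val_one, one_smul] at this
    exact (A_anti _ _).trans (congrArg Neg.neg this)
  have t1 : A ![0, 1, 2, 3, 4, 5, 6] ![3, 4, 5, 1, 2, 6, 7] =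
      -A ![0, 1, 2, 3, 4, 5, 6] ![3, 4, 5, 0, 2, 6, 7] := by
    have := A_perm (swap 0 1) ![0, 1, 2, 3, 4, 5, 6] ![3, 4, 5, 0, 2, 6, 7]
      ![1, 0, 2, 3, 4, 5, 6] ![3, 4, 5, 1, 2, 6, 7] (by decide) (by decide)
    rwa [s01, A01l, Units.val_neg, Units.val_one, neg_one_smul] at this
  have t2 : A ![0, 1, 2, 3, 4, 5, 6] ![3, 4, 5, 1, 2, 6, 7] =
      A ![0, 1, 2, 3, 4, 5, 6] ![3, 4, 5, 0, 1, 6, 7] := by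
    have := A_perm c3 ![0, 1, 2, 3, 4, 5, 6] ![3, 4, 5, 0, 1, 6, 7]
      ![1, 2, 0, 3, 4, 5, 6] ![3, 4, 5, 1, 2, 6, 7] (by decide) (by decide)
    rwa [sc3, A12l, A01l, Units.val_one, one_smul] at this
  have inj : ∀ (τ : Perm (Fin 9)) (z : Fin 5 → Fin 9), Function.Injective z →
      Function.Injective (τ ∘ z) := fun τ z hz => τ.injective.comp hz
  have lin : ∀ (q : Fin 5 → Fin 7 → Fin 9) (p : Fin 7 → Fin 9),
      (∀ τ : Perm (Fin 9), ∑ i : Fin 5, ((-1 : ℤ) ^ (i : ℕ)) • S (τ ∘ q i) = 0) →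
      A p (q 0) - A p (q 1) + A p (q 2) - A p (q 3) + A p (q 4) = 0 := by
    intro q p h
    simp only [A]
    rw [← alt_sub, ← alt_add, ← alt_sub, ← alt_add]
    refine (congrArg alt (funext fun τ => ?_)).trans alt_zero
    have h0 := h τ
    simp only [Fin.sum_univ_five] at h0
    unfold wedge
    rw [← mul_sub, ← mul_add, ← mul_sub, ← mul_add, ← map_sub, ← map_add, ← map_sub, ← map_add]
    have h1 : S (τ ∘ q 0) - S (τ ∘ q 1) + S (τ ∘ q 2) - S (τ ∘ q 3) + S (τ ∘ q 4) = 0 := by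
      rw [← h0]
      norm_num
      abel
    rw [h1, map_zero, mul_zero]
  have t0 : A ![0, 1, 2, 3, 4, 5, 6] ![3, 4, 5, 1, 2, 6, 7] = 0 := by
    have := lin ![![3, 4, 5, 1, 2, 6, 7], ![3, 4, 5, 0, 2, 6, 7], ![3, 4, 5, 0, 1, 6, 7],
      ![3, 4, 5, 0, 1, 2, 7], ![3, 4, 5, 0, 1, 2, 6]] ![0, 1, 2, 3, 4, 5, 6] (fun τ => by
        have := five_term (d := G (τ 3) (τ 4) (τ 5)) (((hG.cons _).cons _).cons _)
          (τ ∘ ![0, 1, 2, 6, 7]) (fun i j hij => hne (τ ∘ ![3, 4, 5, ![0, 1, 2, 6, 7] i,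
            ![0, 1, 2, 6, 7] j]) (inj _ _ (by revert i j; decide)))
        simp only [Fin.sum_univ_five] at this ⊢
        exact this)
    simp only [Matrix.cons_val] at this
    rw [t3, t4, ← t2, sub_zero, add_zero, eq_neg_iff_add_eq_zero.mpr
      ((add_comm _ _).trans (eq_neg_iff_add_eq_zero.mp t1)), sub_neg_eq_add] at this
    exact three _ this
  have r4 : A ![0, 1, 2, 3, 4, 5, 6] ![3, 4, 7, 0, 1, 2, 5] = 0 := by
    have h := A_perm (swap 2 7 * swap 7 6 * swap 6 5 * swap 1 4 * swap 0 3)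
      ![0, 1, 2, 3, 4, 5, 6] ![3, 4, 5, 0, 1, 6, 7] ![3, 4, 7, 0, 1, 2, 5]
      ![0, 1, 2, 3, 4, 5, 6] (by decide) (by decide)
    rw [← t2, t0, smul_zero] at h
    rw [A_anti, h, neg_zero]
  have r1 : A ![0, 1, 2, 3, 4, 5, 6] ![3, 4, 0, 1, 2, 5, 7] =
      -A ![0, 1, 2, 3, 4, 5, 6] ![3, 4, 1, 0, 2, 5, 7] := by
    have := A_perm (swap 0 1) ![0, 1, 2, 3, 4, 5, 6] ![3, 4, 1, 0, 2, 5, 7]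
      ![1, 0, 2, 3, 4, 5, 6] ![3, 4, 0, 1, 2, 5, 7] (by decide) (by decide)
    rwa [s01, A01l, Units.val_neg, Units.val_one, neg_one_smul] at this
  have r2 : A ![0, 1, 2, 3, 4, 5, 6] ![3, 4, 0, 1, 2, 5, 7] =
      A ![0, 1, 2, 3, 4, 5, 6] ![3, 4, 2, 0, 1, 5, 7] := by
    have := A_perm c3 ![0, 1, 2, 3, 4, 5, 6] ![3, 4, 2, 0, 1, 5, 7]
      ![1, 2, 0, 3, 4, 5, 6] ![3, 4, 0, 1, 2, 5, 7] (by decide) (by decide)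
    rwa [sc3, A12l, A01l, Units.val_one, one_smul] at this
  have r0 : A ![0, 1, 2, 3, 4, 5, 6] ![3, 4, 0, 1, 2, 5, 7] = 0 := by
    have := lin ![![3, 4, 0, 1, 2, 5, 7], ![3, 4, 1, 0, 2, 5, 7], ![3, 4, 2, 0, 1, 5, 7],
      ![3, 4, 5, 0, 1, 2, 7], ![3, 4, 7, 0, 1, 2, 5]] ![0, 1, 2, 3, 4, 5, 6] (fun τ => by
        have := dual_five_term (D := G (τ 3) (τ 4)) ((hG.cons _).cons _)
          (τ ∘ ![0, 1, 2, 5, 7]) (fun i j k hij hik hjk => hne (τ ∘ ![3, 4,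
            ![0, 1, 2, 5, 7] i, ![0, 1, 2, 5, 7] j, ![0, 1, 2, 5, 7] k])
            (inj _ _ (by revert i j k; decide)))
        simp only [Fin.sum_univ_five] at this ⊢
        exact this)
    simp only [Matrix.cons_val] at this
    rw [t3, r4, ← r2, sub_zero, add_zero, eq_neg_iff_add_eq_zero.mpr
      ((add_comm _ _).trans (eq_neg_iff_add_eq_zero.mp r1)), sub_neg_eq_add] at this
    exact three _ this
  have : A ![0, 1, 2, 3, 4, 5, 6] ![0, 3, 4, 1, 2, 5, 7] = 0 := by
    rw [A01r, A12r, r0]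
  exact this

end Vanishing22

section Units

lemma fs_mul {x y : F} (hx : x ≠ 0) (hy : y ≠ 0) : fs F (x * y) = fs F x + fs F y := by
  have h : (Submodule.span ℚ (FSrel F)).mkQ
      (Finsupp.single (x * y) 1 - Finsupp.single x 1 - Finsupp.single y 1) = 0 :=
    (Submodule.Quotient.mk_eq_zero _).2 (Submodule.subset_span (Or.inl ⟨x, y, hx, hy, rfl⟩))
  rw [map_sub, map_sub, sub_sub, sub_eq_zero] at h
  exact h

lemma fs_neg (x : F) : fs F (-x) = fs F x := by
  by_cases hx : x = 0
  · rw [hx, neg_zero]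
  have h1 : fs F (1 : F) = 0 := by
    have := fs_mul (one_ne_zero (α := F)) one_ne_zero
    rwa [mul_one, left_eq_add] at this
  have h2 : fs F (-1 : F) = 0 := by
    have := fs_mul (neg_ne_zero.mpr (one_ne_zero (α := F))) (neg_ne_zero.mpr one_ne_zero)
    rw [neg_mul_neg, one_mul, h1] at this
    exact eq_zero_of_eq_neg (eq_neg_of_add_eq_zero_left this.symm)
  rw [← neg_one_mul, fs_mul (neg_ne_zero.mpr one_ne_zero) hx, h2, zero_add]

variable {ι : Type}

lemma IsDet.fs_perm {k : ℕ} {d : (Fin k → ι) → F} (h : IsDet d) (z : Fin k → ι)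
    (p : Perm (Fin k)) : fs F (d (fun i => z (p i))) = fs F (d z) := by
  rw [h.perm]
  rcases Int.units_eq_one_or (sign p) with h | h <;> simp [h, fs_neg]

end Units

section Reduction

/-- The permutation of `{0, ..., 7}` acting by `a` on the first half and by `b` on the second. -/
def blockPerm (a b : Perm (Fin 4)) : Perm (Fin 8) :=
  (finSumFinEquiv (m := 4) (n := 4)).permCongr (Equiv.sumCongr a b)

lemma blockPerm_castAdd (a b : Perm (Fin 4)) (t : Fin 4) :
    blockPerm a b (Fin.castAdd 4 t) = Fin.castAdd 4 (a t) := by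
  rw [blockPerm, Equiv.permCongr_apply, finSumFinEquiv_symm_apply_castAdd]
  rfl

lemma blockPerm_natAdd (a b : Perm (Fin 4)) (t : Fin 4) :
    blockPerm a b (Fin.natAdd 4 t) = Fin.natAdd 4 (b t) := by
  rw [blockPerm, Equiv.permCongr_apply, finSumFinEquiv_symm_apply_natAdd]
  rfl

lemma sign_blockPerm (a b : Perm (Fin 4)) : sign (blockPerm a b) = sign a * sign b := by
  rw [blockPerm, Equiv.Perm.sign_permCongr]
  exact Equiv.Perm.sign_sumCongr a b

lemma sign_mul_self_int {n : ℕ} (a : Perm (Fin n)) : (sign a : ℤ) * (sign a : ℤ) = 1 := by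
  rw [← Units.val_mul, Int.units_mul_self, Units.val_one]

variable {ι : Type}

/-- The generalized cross-ratio of the points numbered `0 | 1, 2, 3, 5, 6, 7`. -/
def rTerm (D : ι → ι → ι → ι → F) (z : Fin 8 → ι) : QF F :=
  r3Q (D (z 0)) ![z 1, z 2, z 3, z 5, z 6, z 7]

/-- The leading summand of `μ_3` of the points numbered `0, 4 | 1, 2, 3; 5, 6, 7`. -/
def cTerm (D : ι → ι → ι → ι → F) (z : Fin 8 → ι) : QF F :=
  gen (crQ (D (z 0) (z 4)) (z 1) (z 6) (z 2) (z 5)) -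
    gen (crQ (D (z 0) (z 4)) (z 1) (z 5) (z 2) (z 6))

/-- The product of the determinants of the two halves of an `8`-tuple. -/
def eTerm (D : ι → ι → ι → ι → F) (z : Fin 8 → ι) : FS F :=
  fs F (D (z 4) (z 5) (z 6) (z 7)) + fs F (D (z 0) (z 1) (z 2) (z 3))

variable {M : Type} [AddCommGroup M]

lemma alt_blockPerm (g : Perm (Fin 8) → M) (a b : Perm (Fin 4)) :
    ((sign a : ℤ) * (sign b : ℤ)) • alt (fun σ => g (σ * blockPerm a b)) = alt g := by
  rw [alt_mul_right, smul_smul, sign_blockPerm, Units.val_mul, mul_mul_mul_comm,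
    sign_mul_self_int, sign_mul_self_int, one_mul, one_smul]

variable [Module ℚ M]

/-- Alternation collapses `a_3` to one generalized cross-ratio and two cross-ratios. -/
lemma alt_a3Q (D : ι → ι → ι → ι → F) (u : Fin 8 → ι) (P : Perm (Fin 8) → QF F →ₗ[ℚ] M)
    (hP : ∀ σ a b, P (σ * blockPerm a b) = P σ) :
    alt (fun σ => P σ (a3Q D (fun t => u (σ (Fin.castAdd 4 t)))
      (fun t => u (σ (Fin.natAdd 4 t))))) =
    (8 / 3 : ℚ) • alt (fun σ => P σ (rTerm D (u ∘ σ))) -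
      (48 : ℚ) • alt (fun σ => P σ (cTerm D (u ∘ σ))) := by
  have hs : ∀ i j : Fin 4, ((-1 : ℤ) ^ ((i : ℕ) + (j : ℕ))) =
      (sign i.cycleRange.symm : ℤ) * (sign j.cycleRange.symm : ℤ) := fun i j => by
    rw [sign_cycleRange_symm, sign_cycleRange_symm, pow_add]
  have hc : ∀ (σ : Perm (Fin 8)) a b t, (σ * blockPerm a b) (Fin.castAdd 4 t) =
      σ (Fin.castAdd 4 (a t)) := fun σ a b t => by rw [Perm.mul_apply, blockPerm_castAdd]
  have hn : ∀ (σ : Perm (Fin 8)) a b t, (σ * blockPerm a b) (Fin.natAdd 4 t) =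
      σ (Fin.natAdd 4 (b t)) := fun σ a b t => by rw [Perm.mul_apply, blockPerm_natAdd]
  have collapse : ∀ (f : Fin 4 → Fin 4 → Perm (Fin 8) → QF F) (g : Perm (Fin 8) → QF F),
      (∀ i j σ, f i j σ = g (σ * blockPerm i.cycleRange.symm j.cycleRange.symm)) →
      alt (fun σ => P σ (∑ i : Fin 4, ∑ j : Fin 4, ((-1 : ℤ) ^ ((i : ℕ) + (j : ℕ))) • f i j σ)) =
        (16 : ℚ) • alt (fun σ => P σ (g σ)) := by
    intro f g h
    simp only [map_sum, map_zsmul, alt_sum, h, hs]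
    have : ∀ i j : Fin 4, alt (fun σ => ((sign i.cycleRange.symm : ℤ) *
        (sign j.cycleRange.symm : ℤ)) •
        P σ (g (σ * blockPerm i.cycleRange.symm j.cycleRange.symm))) =
        alt (fun σ => P σ (g σ)) := by
      intro i j
      rw [alt_zsmul, ← alt_blockPerm (fun σ => P σ (g σ)) i.cycleRange.symm j.cycleRange.symm]
      simp only [hP]
    simp only [this, Finset.sum_const, Finset.card_univ, Fintype.card_fin, smul_smul]
    rw [← Nat.cast_smul_eq_nsmul ℚ]
    norm_num
  have h1 : alt (fun σ => P σ (a3pQ D (fun t => u (σ (Fin.castAdd 4 t)))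
      (fun t => u (σ (Fin.natAdd 4 t))))) =
      (16 : ℚ) • alt (fun σ => P σ (rTerm D (u ∘ σ))) := by
    refine collapse (fun i j σ => r3Q (D (u (σ (Fin.castAdd 4 i))))
      ![u (σ (Fin.castAdd 4 (i.succAbove 0))), u (σ (Fin.castAdd 4 (i.succAbove 1))),
        u (σ (Fin.castAdd 4 (i.succAbove 2))), u (σ (Fin.natAdd 4 (j.succAbove 0))),
        u (σ (Fin.natAdd 4 (j.succAbove 1))), u (σ (Fin.natAdd 4 (j.succAbove 2)))]) _ ?_
    intro i j σ
    have c0 := hc σ i.cycleRange.symm j.cycleRange.symm 0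
    have c1 := fun k : Fin 3 => hc σ i.cycleRange.symm j.cycleRange.symm k.succ
    have n1 := fun k : Fin 3 => hn σ i.cycleRange.symm j.cycleRange.symm k.succ
    simp only [Fin.cycleRange_symm_zero, Fin.cycleRange_symm_succ] at c0 c1 n1
    simp only [← c0, ← c1, ← n1]
    rfl
  have h2 : alt (fun σ => P σ (a3ppQ D (fun t => u (σ (Fin.castAdd 4 t)))
      (fun t => u (σ (Fin.natAdd 4 t))))) =
      (16 : ℚ) • alt (fun σ => P σ (mu3 (crQ (D (u (σ 0)) (u (σ 4))))
        ![u (σ 1), u (σ 2), u (σ 3)] ![u (σ 5), u (σ 6), u (σ 7)])) := by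
    refine collapse (fun i j σ => mu3 (crQ (D (u (σ (Fin.castAdd 4 i)))
      (u (σ (Fin.natAdd 4 j))))) (fun k => u (σ (Fin.castAdd 4 (i.succAbove k))))
        (fun k => u (σ (Fin.natAdd 4 (j.succAbove k)))))
        (fun σ => mu3 (crQ (D (u (σ 0)) (u (σ 4))))
        ![u (σ 1), u (σ 2), u (σ 3)] ![u (σ 5), u (σ 6), u (σ 7)]) ?_
    intro i j σ
    have c0 := hc σ i.cycleRange.symm j.cycleRange.symm 0
    have n0 := hn σ i.cycleRange.symm j.cycleRange.symm 0
    have c1 := fun k : Fin 3 => hc σ i.cycleRange.symm j.cycleRange.symm k.succ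
    have n1 := fun k : Fin 3 => hn σ i.cycleRange.symm j.cycleRange.symm k.succ
    simp only [Fin.cycleRange_symm_zero, Fin.cycleRange_symm_succ] at c0 c1 n0 n1
    simp only [← c0, ← c1, ← n0, ← n1]
    congr 1 <;> funext k <;> fin_cases k <;> rfl
  have h3 : alt (fun σ => P σ (mu3 (crQ (D (u (σ 0)) (u (σ 4))))
        ![u (σ 1), u (σ 2), u (σ 3)] ![u (σ 5), u (σ 6), u (σ 7)])) =
      (9 : ℚ) • alt (fun σ => P σ (cTerm D (u ∘ σ))) := by
    have : ∀ α β : Perm (Fin 3), alt (fun σ => ((sign α : ℤ) * (sign β : ℤ)) •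
        P σ (cTerm D (u ∘ (σ * blockPerm (extendPerm α) (extendPerm β) : Perm (Fin 8))))) =
        alt (fun σ => P σ (cTerm D (u ∘ σ))) := by
      intro α β
      have h := alt_blockPerm (fun σ => P σ (cTerm D (u ∘ σ))) (extendPerm α) (extendPerm β)
      rw [sign_extendPerm, sign_extendPerm] at h
      rw [alt_zsmul, ← h]
      simp only [hP]
    have hx : ∀ (σ : Perm (Fin 8)) (α β : Perm (Fin 3)),
        gen (crQ (D (u (σ 0)) (u (σ 4))) (![u (σ 1), u (σ 2), u (σ 3)] (α 0))
          (![u (σ 5), u (σ 6), u (σ 7)] (β 1)) (![u (σ 1), u (σ 2), u (σ 3)] (α 1))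
          (![u (σ 5), u (σ 6), u (σ 7)] (β 0))) -
        gen (crQ (D (u (σ 0)) (u (σ 4))) (![u (σ 1), u (σ 2), u (σ 3)] (α 0))
          (![u (σ 5), u (σ 6), u (σ 7)] (β 0)) (![u (σ 1), u (σ 2), u (σ 3)] (α 1))
          (![u (σ 5), u (σ 6), u (σ 7)] (β 1))) =
        cTerm D (u ∘ (σ * blockPerm (extendPerm α) (extendPerm β) : Perm (Fin 8))) := by
      intro σ α β
      have c0 := hc σ (extendPerm α) (extendPerm β) 0
      have n0 := hn σ (extendPerm α) (extendPerm β) 0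
      have c1 := fun k : Fin 3 => hc σ (extendPerm α) (extendPerm β) k.succ
      have n1 := fun k : Fin 3 => hn σ (extendPerm α) (extendPerm β) k.succ
      simp only [extendPerm_zero, extendPerm_succ] at c0 c1 n0 n1
      have hl : ∀ k : Fin 3, ![u (σ 1), u (σ 2), u (σ 3)] k =
        u (σ (Fin.castAdd 4 k.succ)) := fun k => by fin_cases k <;> rfl
      have hm : ∀ k : Fin 3, ![u (σ 5), u (σ 6), u (σ 7)] k =
        u (σ (Fin.natAdd 4 k.succ)) := fun k => by fin_cases k <;> rfl
      change σ.1 0 = _ at c0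
      simp only [hl, hm, ← c1, ← n1]
      rw [show σ 0 = _ from c0.symm, show σ 4 = _ from n0.symm]
      rfl
    simp only [mu3, hx, map_smul, map_sum, map_zsmul, alt_qsmul, alt_sum, this]
    simp only [Finset.sum_const, Finset.card_univ, Fintype.card_perm, Fintype.card_fin]
    rw [← Nat.cast_smul_eq_nsmul ℚ, ← Nat.cast_smul_eq_nsmul ℚ, smul_smul, smul_smul]
    norm_num [Nat.factorial]
  simp only [a3Q, map_sub, map_smul]
  rw [alt_sub, alt_qsmul, alt_qsmul, h1, h2, h3]
  simp only [smul_smul]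
  norm_num

lemma eTerm_blockPerm {D : ι → ι → ι → ι → F}
    (hD : IsDet fun z : Fin 4 → ι => D (z 0) (z 1) (z 2) (z 3)) (u : Fin 8 → ι)
    (σ : Perm (Fin 8)) (a b : Perm (Fin 4)) :
    eTerm D (u ∘ (σ * blockPerm a b : Perm (Fin 8))) = eTerm D (u ∘ σ) := by
  have h1 := hD.fs_perm (fun t => u (σ (Fin.natAdd 4 t))) b
  have h2 := hD.fs_perm (fun t => u (σ (Fin.castAdd 4 t))) a
  simp only [← blockPerm_natAdd a b, ← blockPerm_castAdd a b] at h1 h2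
  exact congrArg₂ (· + ·) h1 h2

lemma phi31Q_eq {D : ι → ι → ι → ι → F}
    (hD : IsDet fun z : Fin 4 → ι => D (z 0) (z 1) (z 2) (z 3)) (u : Fin 8 → ι) :
    phi31Q D u =
      (8 / 3 : ℚ) • alt (fun σ => clsB3 F (rTerm D (u ∘ σ)) ⊗ₜ[ℚ] eTerm D (u ∘ σ)) -
        (48 : ℚ) • alt (fun σ => clsB3 F (cTerm D (u ∘ σ)) ⊗ₜ[ℚ] eTerm D (u ∘ σ)) :=
  alt_a3Q D u
    (fun σ => ((TensorProduct.mk ℚ (B3 F) (FS F)).flip (eTerm D (u ∘ σ))).comp (clsB3 F))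
    fun σ a b => by rw [eTerm_blockPerm hD]

lemma sum_phi31Q (D : Fin 9 → Fin 9 → Fin 9 → Fin 9 → Fin 9 → F)
    (hD : ∀ i, IsDet fun z : Fin 4 → Fin 9 => D i (z 0) (z 1) (z 2) (z 3)) :
    ∑ i : Fin 9, ((-1 : ℤ) ^ (i : ℕ)) • phi31Q (D i) i.succAbove =
      (8 / 3 : ℚ) • alt (fun τ : Perm (Fin 9) =>
        clsB3 F (rTerm (D (τ 0)) (τ ∘ Fin.succ)) ⊗ₜ[ℚ] eTerm (D (τ 0)) (τ ∘ Fin.succ)) -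
      (48 : ℚ) • alt (fun τ : Perm (Fin 9) =>
        clsB3 F (cTerm (D (τ 0)) (τ ∘ Fin.succ)) ⊗ₜ[ℚ] eTerm (D (τ 0)) (τ ∘ Fin.succ)) := by
  have h1 := sum_alt_succAbove fun i z =>
    clsB3 F (rTerm (D i) z) ⊗ₜ[ℚ] eTerm (D i) z
  have h2 := sum_alt_succAbove fun i z =>
    clsB3 F (cTerm (D i) z) ⊗ₜ[ℚ] eTerm (D i) z
  change _ = alt (fun τ : Perm (Fin 9) =>
    clsB3 F (rTerm (D (τ 0)) (τ ∘ Fin.succ)) ⊗ₜ[ℚ] eTerm (D (τ 0)) (τ ∘ Fin.succ)) at h1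
  change _ = alt (fun τ : Perm (Fin 9) =>
    clsB3 F (cTerm (D (τ 0)) (τ ∘ Fin.succ)) ⊗ₜ[ℚ] eTerm (D (τ 0)) (τ ∘ Fin.succ)) at h2
  rw [← h1, ← h2, Finset.smul_sum, Finset.smul_sum, ← Finset.sum_sub_distrib]
  refine Finset.sum_congr rfl fun i _ => ?_
  rw [phi31Q_eq (hD i), smul_sub, smul_comm, smul_comm _ (48 : ℚ)]
  rfl

end Reduction

section Vanishing31

lemma four_cancel {M : Type} [AddCommGroup M] [Module ℚ M] {a : M} (h : a + a + a + a = 0) :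
    a = 0 := by
  have h4 : (4 : ℚ) • a = 0 := by
    rw [← h, show (4 : ℚ) = 1 + 1 + 1 + 1 by norm_num, add_smul, add_smul, add_smul, one_smul]
  exact (smul_eq_zero.mp h4).resolve_left (by norm_num)

/-- An alternating sum of seven tensors that vanish together, four of which are
rearrangements of the first one and three of which are symmetric. -/
lemma alt_tensor_eq_zero (f : Fin 7 → Perm (Fin 9) → B3 F) (e : Perm (Fin 9) → FS F)
    (hsum : ∀ τ, ∑ i : Fin 7, ((-1 : ℤ) ^ (i : ℕ)) • f i τ = 0)
    (π : Fin 7 → Perm (Fin 9))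
    (hπ : ∀ i : Fin 7, (i : ℕ) < 4 → (sign (π i) : ℤ) = (-1) ^ (i : ℕ))
    (hf : ∀ i : Fin 7, (i : ℕ) < 4 → ∀ τ, f i τ = f 0 (τ * π i))
    (hf' : ∀ i : Fin 7, 4 ≤ (i : ℕ) → ∀ τ, f i τ = f i (τ * π i))
    (hπ' : ∀ i : Fin 7, 4 ≤ (i : ℕ) → sign (π i) = -1)
    (he : ∀ i τ, e τ = e (τ * π i)) :
    alt (fun τ => f 0 τ ⊗ₜ[ℚ] e τ) = 0 := by
  have h0 : ∑ i : Fin 7, ((-1 : ℤ) ^ (i : ℕ)) • alt (fun τ => f i τ ⊗ₜ[ℚ] e τ) = 0 := by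
    simp only [← alt_zsmul]
    rw [← alt_sum]
    refine (congrArg alt (funext fun τ => ?_)).trans alt_zero
    simp only [TensorProduct.smul_tmul']
    rw [← TensorProduct.sum_tmul, hsum, TensorProduct.zero_tmul]
  have h1 : ∀ i : Fin 7, (i : ℕ) < 4 → ((-1 : ℤ) ^ (i : ℕ)) • alt (fun τ => f i τ ⊗ₜ[ℚ] e τ) =
      alt (fun τ => f 0 τ ⊗ₜ[ℚ] e τ) := fun i hi => by
    rw [alt_congr_mul (g := fun τ => f 0 τ ⊗ₜ[ℚ] e τ) (π i)
      (fun τ => by rw [hf i hi, he i]), smul_smul, hπ i hi, ← mul_pow]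
    norm_num
  have h2 : ∀ i : Fin 7, 4 ≤ (i : ℕ) → alt (fun τ => f i τ ⊗ₜ[ℚ] e τ) = 0 := fun i hi =>
    alt_eq_zero_of_odd (π i) (hπ' i hi) fun τ => by rw [← hf' i hi, ← he i]
  apply four_cancel
  rw [← h0, Fin.sum_univ_seven, h1 0 (by decide), h1 1 (by decide), h1 2 (by decide),
    h1 3 (by decide), h2 4 (by decide), h2 5 (by decide), h2 6 (by decide)]
  simp

lemma injective_cons_comp {α : Type} {n : ℕ} {y : Fin n → α} (hy : Function.Injective y) {a : α}
    (ha : ∀ i, a ≠ y i) {i j k l : Fin n} (hij : i ≠ j) (hik : i ≠ k)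
    (hil : i ≠ l) (hjk : j ≠ k) (hjl : j ≠ l) (hkl : k ≠ l) :
    Function.Injective ![a, y i, y j, y k, y l] := by
  simp only [Matrix.vecCons, Fin.cons_injective_iff]
  simp [ha, hy.eq_iff, hij, hik, hil, hjk, hjl, hkl, Function.injective_of_subsingleton]

variable {ι : Type}

lemma alt_cTerm (D : ι → ι → ι → ι → F) (u : Fin 8 → ι) (e : FS F) :
    alt (fun σ : Perm (Fin 8) => clsB3 F (cTerm D (u ∘ σ)) ⊗ₜ[ℚ] e) = 0 :=
  alt_eq_zero_of_swap 3 7 (by decide) fun _ => rfl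

lemma alt_rTerm {D : ι → ι → ι → ι → F}
    (hD : IsDet fun z : Fin 4 → ι => D (z 0) (z 1) (z 2) (z 3)) (u : Fin 8 → ι)
    (hne : ∀ z : Fin 4 → Fin 8, Function.Injective z →
      D (u (z 0)) (u (z 1)) (u (z 2)) (u (z 3)) ≠ 0) (e : FS F) :
    alt (fun σ : Perm (Fin 8) => clsB3 F (rTerm D (u ∘ σ)) ⊗ₜ[ℚ] e) = 0 := by
  let f : Fin 7 → Perm (Fin 8) → B3 F := fun i σ =>
    clsB3 F (r3Q (D (u (σ 0))) (((u ∘ σ) ∘ Fin.succ) ∘ i.succAbove))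
  have hsum : ∀ σ, ∑ i : Fin 7, ((-1 : ℤ) ^ (i : ℕ)) • f i σ = 0 := fun σ =>
    seven_term (hD.cons _) _ fun i j k hij hik hjk =>
      hne (σ ∘ ![0, i.succ, j.succ, k.succ])
        (σ.injective.comp (by revert i j k; decide))
  have hf : ∀ i σ, f i σ = f 0 (σ * extendPerm i.cycleRange.symm) := fun i σ => by
    have hz : (σ * extendPerm i.cycleRange.symm) 0 = σ 0 := by simp
    have hs : ∀ k : Fin 6, (σ * extendPerm i.cycleRange.symm) k.succ.succ =
      σ (i.succAbove k).succ := fun k => by simp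
    simp only [f, hz]
    refine congrArg _ (congrArg _ (funext fun k => ?_))
    simp only [Function.comp_apply, Fin.zero_succAbove, hs]
  have h1 : ∀ i : Fin 7, alt (fun σ => f i σ ⊗ₜ[ℚ] e) =
      ((-1 : ℤ) ^ (i : ℕ)) • alt (fun σ => f 0 σ ⊗ₜ[ℚ] e) := fun i => by
    rw [alt_congr_mul (g := fun σ => f 0 σ ⊗ₜ[ℚ] e) (extendPerm i.cycleRange.symm)
      (fun σ => by rw [hf i]), sign_extendPerm, sign_cycleRange_symm]
  have h0 : ∑ i : Fin 7, ((-1 : ℤ) ^ (i : ℕ)) • alt (fun σ => f i σ ⊗ₜ[ℚ] e) = 0 := by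
    simp only [← alt_zsmul]
    rw [← alt_sum]
    refine (congrArg alt (funext fun σ => ?_)).trans alt_zero
    simp only [TensorProduct.smul_tmul']
    rw [← TensorProduct.sum_tmul, hsum, TensorProduct.zero_tmul]
  have h2 : alt (fun σ => f 0 σ ⊗ₜ[ℚ] e) = 0 := by
    have h4 : ∀ i : Fin 7, ((-1 : ℤ) ^ (i : ℕ)) • alt (fun σ => f i σ ⊗ₜ[ℚ] e) =
        alt (fun σ => f 0 σ ⊗ₜ[ℚ] e) := fun i => by
      rw [h1 i, smul_smul, ← mul_pow]
      norm_num
    rw [Finset.sum_congr rfl fun i _ => h4 i] at h0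
    simp only [Finset.sum_const, Finset.card_univ, Fintype.card_fin] at h0
    rw [← Nat.cast_smul_eq_nsmul ℚ] at h0
    exact (smul_eq_zero.mp h0).resolve_left (by norm_num)
  have h3 := h1 3
  rw [h2, smul_zero] at h3
  rw [← h3]
  refine congrArg alt (funext fun σ => ?_)
  refine congrArg (fun z => clsB3 F (r3Q (D (u (σ 0))) z) ⊗ₜ[ℚ] e) (funext fun k => ?_)
  fin_cases k <;> rfl

lemma alt_a3Q_const {D : ι → ι → ι → ι → F}
    (hD : IsDet fun z : Fin 4 → ι => D (z 0) (z 1) (z 2) (z 3)) (u : Fin 8 → ι)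
    (hne : ∀ z : Fin 4 → Fin 8, Function.Injective z →
      D (u (z 0)) (u (z 1)) (u (z 2)) (u (z 3)) ≠ 0) (e : FS F) :
    alt (fun σ : Perm (Fin 8) => clsB3 F (a3Q D (fun t => u (σ (Fin.castAdd 4 t)))
      (fun t => u (σ (Fin.natAdd 4 t)))) ⊗ₜ[ℚ] e) = 0 := by
  have := alt_a3Q D u
    (fun _ => ((TensorProduct.mk ℚ (B3 F) (FS F)).flip e).comp (clsB3 F)) fun _ _ _ => rfl
  refine this.trans ?_
  have h1 := alt_rTerm hD u hne e
  have h2 := alt_cTerm D u e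
  simp only [LinearMap.comp_apply, LinearMap.flip_apply, TensorProduct.mk_apply]
  rw [h1, h2, smul_zero, smul_zero, sub_zero]

lemma fs_det_swap {D : ι → ι → ι → ι → F}
    (hD : IsDet fun z : Fin 4 → ι => D (z 0) (z 1) (z 2) (z 3)) (a b c d : ι)
    (p : Perm (Fin 4)) : fs F (D (![a, b, c, d] (p 0)) (![a, b, c, d] (p 1))
      (![a, b, c, d] (p 2)) (![a, b, c, d] (p 3))) = fs F (D a b c d) :=
  hD.fs_perm ![a, b, c, d] p

/-- The `9`-term relation for the `B_3 ⊗ F^*`-component. -/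
lemma phi31_nine_term {D : Fin 9 → Fin 9 → Fin 9 → Fin 9 → F}
    (hD : IsDet fun z : Fin 4 → Fin 9 => D (z 0) (z 1) (z 2) (z 3))
    (hne : ∀ z : Fin 4 → Fin 9, Function.Injective z →
      D (z 0) (z 1) (z 2) (z 3) ≠ 0) :
    ∑ i : Fin 9, ((-1 : ℤ) ^ (i : ℕ)) • phi31Q D i.succAbove = 0 := by
  have hr1 : alt (fun τ : Perm (Fin 9) => clsB3 F (rTerm D (τ ∘ Fin.succ)) ⊗ₜ[ℚ]
      fs F (D (τ 1) (τ 2) (τ 3) (τ 4))) = 0 :=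
    alt_eq_zero_of_swap 0 5 (by decide) fun _ => rfl
  have hc1 : alt (fun τ : Perm (Fin 9) => clsB3 F (cTerm D (τ ∘ Fin.succ)) ⊗ₜ[ℚ]
      fs F (D (τ 1) (τ 2) (τ 3) (τ 4))) = 0 :=
    alt_eq_zero_of_swap 0 8 (by decide) fun _ => rfl
  have hc2 : alt (fun τ : Perm (Fin 9) => clsB3 F (cTerm D (τ ∘ Fin.succ)) ⊗ₜ[ℚ]
      fs F (D (τ 5) (τ 6) (τ 7) (τ 8))) = 0 :=
    alt_eq_zero_of_swap 0 4 (by decide) fun _ => rfl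
  have hr2 : alt (fun τ : Perm (Fin 9) => clsB3 F (rTerm D (τ ∘ Fin.succ)) ⊗ₜ[ℚ]
      fs F (D (τ 5) (τ 6) (τ 7) (τ 8))) = 0 := by
    let y : Fin 7 → Fin 9 := ![0, 2, 3, 4, 6, 7, 8]
    have key := alt_tensor_eq_zero
      (fun i τ => clsB3 F (r3Q (D (τ 1)) ((τ ∘ y) ∘ i.succAbove)))
      (fun τ => fs F (D (τ 5) (τ 6) (τ 7) (τ 8)))
      (fun τ => seven_term (hD.cons _) _ fun i j k hij hik hjk =>
        hne (τ ∘ ![1, y i, y j, y k]) (τ.injective.comp (by revert i j k; decide)))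
      ![1, swap 0 2, swap 0 3 * swap 3 2, swap 0 4 * swap 4 3 * swap 3 2,
        swap 5 6, swap 5 7, swap 5 8]
      (by decide) ?_ ?_ (by decide) ?_
    · refine Eq.trans (congrArg alt (funext fun τ => ?_)) key
      refine congrArg (fun z => clsB3 F (r3Q (D (τ 1)) z) ⊗ₜ[ℚ] _) (funext fun k => ?_)
      fin_cases k <;> rfl
    · intro i hi τ
      refine congrArg (clsB3 F) (congrArg₂ r3Q (congrArg D (congrArg τ ?_))
        (funext fun k => congrArg τ ?_))
      · revert i; decide
      · revert i k; decide
    · intro i hi τ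
      refine congrArg (clsB3 F) (congrArg₂ r3Q (congrArg D (congrArg τ ?_))
        (funext fun k => congrArg τ ?_))
      · revert i; decide
      · revert i k; decide
    · intro i τ
      fin_cases i
      · rfl
      · rfl
      · rfl
      · rfl
      · exact (fs_det_swap hD (τ 5) (τ 6) (τ 7) (τ 8) (swap 0 1)).symm
      · exact (fs_det_swap hD (τ 5) (τ 6) (τ 7) (τ 8) (swap 0 2)).symm
      · exact (fs_det_swap hD (τ 5) (τ 6) (τ 7) (τ 8) (swap 0 3)).symm
  rw [sum_phi31Q (fun _ => D) fun _ => hD]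
  simp only [eTerm, TensorProduct.tmul_add, alt_add]
  change (8 / 3 : ℚ) • (alt (fun τ : Perm (Fin 9) => clsB3 F (rTerm D (τ ∘ Fin.succ)) ⊗ₜ[ℚ]
      fs F (D (τ 5) (τ 6) (τ 7) (τ 8))) + alt (fun τ : Perm (Fin 9) =>
      clsB3 F (rTerm D (τ ∘ Fin.succ)) ⊗ₜ[ℚ] fs F (D (τ 1) (τ 2) (τ 3) (τ 4)))) -
    (48 : ℚ) • (alt (fun τ : Perm (Fin 9) => clsB3 F (cTerm D (τ ∘ Fin.succ)) ⊗ₜ[ℚ]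
      fs F (D (τ 5) (τ 6) (τ 7) (τ 8))) + alt (fun τ : Perm (Fin 9) =>
      clsB3 F (cTerm D (τ ∘ Fin.succ)) ⊗ₜ[ℚ] fs F (D (τ 1) (τ 2) (τ 3) (τ 4)))) = 0
  rw [hr1, hr2, hc1, hc2]
  simp

/-- The dual `9`-term relation for the `B_3 ⊗ F^*`-component. -/
lemma phi31_dual_nine_term {G : Fin 9 → Fin 9 → Fin 9 → Fin 9 → Fin 9 → F}
    (hG : IsDet fun z : Fin 5 → Fin 9 => G (z 0) (z 1) (z 2) (z 3) (z 4))
    (hne : ∀ z : Fin 5 → Fin 9, Function.Injective z →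
      G (z 0) (z 1) (z 2) (z 3) (z 4) ≠ 0) :
    ∑ i : Fin 9, ((-1 : ℤ) ^ (i : ℕ)) • phi31Q (G i) i.succAbove = 0 := by
  have G01 : ∀ a b c d e, G b a c d e = -G a b c d e := fun a b c d e =>
    hG.swap ![a, b, c, d, e] (show (0 : Fin 5) ≠ 1 by decide)
  have G02 : ∀ a b c d e, G c b a d e = -G a b c d e := fun a b c d e =>
    hG.swap ![a, b, c, d, e] (show (0 : Fin 5) ≠ 2 by decide)
  have G03 : ∀ a b c d e, G d b c a e = -G a b c d e := fun a b c d e =>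
    hG.swap ![a, b, c, d, e] (show (0 : Fin 5) ≠ 3 by decide)
  have G04 : ∀ a b c d e, G e b c d a = -G a b c d e := fun a b c d e =>
    hG.swap ![a, b, c, d, e] (show (0 : Fin 5) ≠ 4 by decide)
  have r3_neg : ∀ (d d' : Fin 9 → Fin 9 → Fin 9 → F), (∀ x y t, d' x y t = -d x y t) →
      ∀ z, r3Q d' z = r3Q d z := fun d d' h z =>
    r3Q_congr (-1) (neg_ne_zero.mpr one_ne_zero) (fun _ => 1) (fun _ => one_ne_zero)
      (fun i j l => by rw [h]; ring)
  have cr_neg : ∀ (d d' : Fin 9 → Fin 9 → F), (∀ x y, d' x y = -d x y) →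
      ∀ a b c e, crQ d' a b c e = crQ d a b c e := fun d d' h a b c e => by
    simp only [crQ, h, neg_mul_neg]
  have fs01 : ∀ a b c d e, fs F (G b a c d e) = fs F (G a b c d e) := fun a b c d e => by
    rw [G01, fs_neg]
  have hr1 : alt (fun τ : Perm (Fin 9) => clsB3 F (rTerm (G (τ 0)) (τ ∘ Fin.succ)) ⊗ₜ[ℚ]
      fs F (G (τ 0) (τ 1) (τ 2) (τ 3) (τ 4))) = 0 :=
    alt_eq_zero_of_swap 0 1 (by decide) fun τ => by
      change clsB3 F (r3Q (G (τ 0) (τ 1)) ![τ 2, τ 3, τ 4, τ 6, τ 7, τ 8]) ⊗ₜ[ℚ] _ =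
        clsB3 F (r3Q (G (τ 1) (τ 0)) ![τ 2, τ 3, τ 4, τ 6, τ 7, τ 8]) ⊗ₜ[ℚ]
        fs F (G (τ 1) (τ 0) (τ 2) (τ 3) (τ 4))
      rw [r3_neg _ _ (fun _ _ _ => G01 _ _ _ _ _), G01, fs_neg]
  have hc1 : alt (fun τ : Perm (Fin 9) => clsB3 F (cTerm (G (τ 0)) (τ ∘ Fin.succ)) ⊗ₜ[ℚ]
      fs F (G (τ 0) (τ 1) (τ 2) (τ 3) (τ 4))) = 0 :=
    alt_eq_zero_of_swap 0 1 (by decide) fun τ => by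
      change _ = clsB3 F (gen (crQ (G (τ 1) (τ 0) (τ 5)) (τ 2) (τ 7) (τ 3) (τ 6)) -
        gen (crQ (G (τ 1) (τ 0) (τ 5)) (τ 2) (τ 6) (τ 3) (τ 7))) ⊗ₜ[ℚ]
        fs F (G (τ 1) (τ 0) (τ 2) (τ 3) (τ 4))
      rw [fs01]
      exact congrArg₂ (fun a b => clsB3 F (gen a - gen b) ⊗ₜ[ℚ] _)
        (cr_neg _ _ (fun _ _ => G01 _ _ _ _ _) _ _ _ _).symm
        (cr_neg _ _ (fun _ _ => G01 _ _ _ _ _) _ _ _ _).symm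
  have hc2 : alt (fun τ : Perm (Fin 9) => clsB3 F (cTerm (G (τ 0)) (τ ∘ Fin.succ)) ⊗ₜ[ℚ]
      fs F (G (τ 0) (τ 5) (τ 6) (τ 7) (τ 8))) = 0 :=
    alt_eq_zero_of_swap 0 5 (by decide) fun τ => by
      change _ = clsB3 F (gen (crQ (G (τ 5) (τ 1) (τ 0)) (τ 2) (τ 7) (τ 3) (τ 6)) -
        gen (crQ (G (τ 5) (τ 1) (τ 0)) (τ 2) (τ 6) (τ 3) (τ 7))) ⊗ₜ[ℚ]
        fs F (G (τ 5) (τ 0) (τ 6) (τ 7) (τ 8))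
      rw [fs01]
      exact congrArg₂ (fun a b => clsB3 F (gen a - gen b) ⊗ₜ[ℚ] _)
        (cr_neg _ _ (fun _ _ => G02 _ _ _ _ _) _ _ _ _).symm
        (cr_neg _ _ (fun _ _ => G02 _ _ _ _ _) _ _ _ _).symm
  have hr2 : alt (fun τ : Perm (Fin 9) => clsB3 F (rTerm (G (τ 0)) (τ ∘ Fin.succ)) ⊗ₜ[ℚ]
      fs F (G (τ 0) (τ 5) (τ 6) (τ 7) (τ 8))) = 0 := by
    let y : Fin 7 → Fin 9 := ![1, 2, 3, 4, 6, 7, 8]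
    have key := alt_tensor_eq_zero
      (fun i τ => clsB3 F (r3Q (G (τ 0) (τ (y i))) ((τ ∘ y) ∘ i.succAbove)))
      (fun τ => fs F (G (τ 0) (τ 5) (τ 6) (τ 7) (τ 8)))
      (fun τ => dual_seven_term (hG.cons _) (τ ∘ y) fun i j k l hij hik hil hjk hjl hkl =>
        hne (τ ∘ ![0, y i, y j, y k, y l]) (τ.injective.comp
          (injective_cons_comp (by decide) (by decide) hij hik hil hjk hjl hkl)))
      ![1, swap 1 2, swap 1 3 * swap 3 2, swap 1 4 * swap 4 3 * swap 3 2,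
        swap 0 6, swap 0 7, swap 0 8]
      (by decide) ?_ ?_ (by decide) ?_
    · refine Eq.trans (congrArg alt (funext fun τ => ?_)) key
      refine congrArg (fun z => clsB3 F (r3Q (G (τ 0) (τ 1)) z) ⊗ₜ[ℚ] _) (funext fun k => ?_)
      fin_cases k <;> rfl
    · intro i hi τ
      refine congrArg (clsB3 F) (congrArg₂ r3Q (congrArg₂ G (congrArg τ ?_) (congrArg τ ?_))
        (funext fun k => congrArg τ ?_))
      · revert i; decide
      · revert i; decide
      · revert i k; decide
    · intro i hi τ
      refine congrArg (clsB3 F) (Eq.trans (r3_neg (G (τ (y i)) (τ 0)) (G (τ 0) (τ (y i)))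
        (fun _ _ _ => G01 _ _ _ _ _) _) (congrArg₂ r3Q (congrArg₂ G (congrArg τ ?_)
        (congrArg τ ?_)) (funext fun k => congrArg τ ?_)))
      · revert i; decide
      · revert i; decide
      · revert i k; decide
    · intro i τ
      fin_cases i
      · rfl
      · rfl
      · rfl
      · rfl
      · exact ((congrArg (fs F) (G02 _ _ _ _ _)).trans (fs_neg _)).symm
      · exact ((congrArg (fs F) (G03 _ _ _ _ _)).trans (fs_neg _)).symm
      · exact ((congrArg (fs F) (G04 _ _ _ _ _)).trans (fs_neg _)).symm
  rw [sum_phi31Q G fun i => hG.cons i]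
  simp only [eTerm, TensorProduct.tmul_add, alt_add]
  change (8 / 3 : ℚ) • (alt (fun τ : Perm (Fin 9) =>
      clsB3 F (rTerm (G (τ 0)) (τ ∘ Fin.succ)) ⊗ₜ[ℚ]
      fs F (G (τ 0) (τ 5) (τ 6) (τ 7) (τ 8))) + alt (fun τ : Perm (Fin 9) =>
      clsB3 F (rTerm (G (τ 0)) (τ ∘ Fin.succ)) ⊗ₜ[ℚ] fs F (G (τ 0) (τ 1) (τ 2) (τ 3) (τ 4)))) -
    (48 : ℚ) • (alt (fun τ : Perm (Fin 9) => clsB3 F (cTerm (G (τ 0)) (τ ∘ Fin.succ)) ⊗ₜ[ℚ]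
      fs F (G (τ 0) (τ 5) (τ 6) (τ 7) (τ 8))) + alt (fun τ : Perm (Fin 9) =>
      clsB3 F (cTerm (G (τ 0)) (τ ∘ Fin.succ)) ⊗ₜ[ℚ]
      fs F (G (τ 0) (τ 1) (τ 2) (τ 3) (τ 4)))) = 0
  rw [hr1, hr2, hc1, hc2]
  simp

end Vanishing31

section Invariance

lemma phi22Q_nine_term (D : Fin 9 → Fin 9 → Fin 9 → Fin 9 → F) :
    ∑ i : Fin 9, ((-1 : ℤ) ^ (i : ℕ)) • phi22Q D i.succAbove = 0 := by
  have h := sum_alt_succAbove (M := LamB2 F) (n := 8) fun _ z =>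
    wedge (b2 F (crQ (D (z 0) (z 1)) (z 2) (z 3) (z 4) (z 5)))
      (b2 F (crQ (D (z 2) (z 3)) (z 0) (z 1) (z 4) (z 6)))
  simp only [phi22Q, smul_comm _ (288 / 7 : ℚ)]
  rw [← Finset.smul_sum]
  exact (congrArg _ (h.trans (phi22_nine_term D id))).trans (smul_zero _)

lemma phi22Q_dual_nine_term {G : Fin 9 → Fin 9 → Fin 9 → Fin 9 → Fin 9 → F}
    (hG : IsDet fun z : Fin 5 → Fin 9 => G (z 0) (z 1) (z 2) (z 3) (z 4))
    (hne : ∀ z : Fin 5 → Fin 9, Function.Injective z →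
      G (z 0) (z 1) (z 2) (z 3) (z 4) ≠ 0) :
    ∑ i : Fin 9, ((-1 : ℤ) ^ (i : ℕ)) • phi22Q (G i) i.succAbove = 0 := by
  have h := sum_alt_succAbove (M := LamB2 F) (n := 8) fun i z =>
    wedge (b2 F (crQ (G i (z 0) (z 1)) (z 2) (z 3) (z 4) (z 5)))
      (b2 F (crQ (G i (z 2) (z 3)) (z 0) (z 1) (z 4) (z 6)))
  simp only [phi22Q, smul_comm _ (288 / 7 : ℚ)]
  rw [← Finset.smul_sum]
  exact (congrArg _ (h.trans (phi22_dual_nine_term G hG hne))).trans (smul_zero _)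

lemma alt_mul_left {M : Type} [AddCommGroup M] {n : ℕ} (f : Perm (Fin n) → M)
    (π : Perm (Fin n)) : alt (fun σ => f (π * σ)) = (sign π : ℤ) • alt f := by
  unfold alt
  rw [← Equiv.sum_comp (Equiv.mulLeft π) (fun σ => (sign σ : ℤ) • f σ), Finset.smul_sum]
  refine Finset.sum_congr rfl fun σ _ => ?_
  rw [Equiv.coe_mulLeft, Perm.sign_mul, smul_smul, Units.val_mul, ← mul_assoc,
    sign_mul_self_int, one_mul]

variable {ι κ : Type} {D : ι → ι → ι → ι → F} {D' : κ → κ → κ → κ → F}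
  {u : Fin 8 → ι} {u' : Fin 8 → κ} {k : F} {c : Fin 8 → F}

lemma phi31Q_comp_perm (D : ι → ι → ι → ι → F) (u : Fin 8 → ι) (π : Perm (Fin 8)) :
    phi31Q D (u ∘ π) = (sign π : ℤ) • phi31Q D u := by
  unfold phi31Q
  rw [← alt_mul_left]
  rfl

lemma phi22Q_comp_perm (D : ι → ι → ι → ι → F) (u : Fin 8 → ι) (π : Perm (Fin 8)) :
    phi22Q D (u ∘ π) = (sign π : ℤ) • phi22Q D u := by
  unfold phi22Q
  rw [smul_comm]
  exact congrArg _ (alt_mul_left (fun σ : Perm (Fin 8) =>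
    wedge (b2 F (crQ (D (u (σ 0)) (u (σ 1))) (u (σ 2)) (u (σ 3)) (u (σ 4)) (u (σ 5))))
      (b2 F (crQ (D (u (σ 2)) (u (σ 3))) (u (σ 0)) (u (σ 1)) (u (σ 4)) (u (σ 6))))) π)

lemma crQ_rescale
    (hk : k ≠ 0) (hc : ∀ i, c i ≠ 0)
    (h : ∀ p q r s, D' (u' p) (u' q) (u' r) (u' s) =
      k * (c p * c q * c r * c s) * D (u p) (u q) (u r) (u s)) (p q a b e f : Fin 8) :
    crQ (D' (u' p) (u' q)) (u' a) (u' b) (u' e) (u' f) =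
      crQ (D (u p) (u q)) (u a) (u b) (u e) (u f) := by
  refine crQ_congr (k * (c p * c q)) (c a) (c b) (c e) (c f) (by simp [hk, hc]) (hc a) (hc b)
    (hc e) (hc f) ?_ ?_ ?_ ?_ <;> rw [h] <;> ring

lemma a3Q_rescale
    (hk : k ≠ 0) (hc : ∀ i, c i ≠ 0)
    (h : ∀ p q r s, D' (u' p) (u' q) (u' r) (u' s) =
      k * (c p * c q * c r * c s) * D (u p) (u q) (u r) (u s)) (l m : Fin 4 → Fin 8) :
    a3Q D' (fun t => u' (l t)) (fun t => u' (m t)) =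
      a3Q D (fun t => u (l t)) (fun t => u (m t)) := by
  have h1 : a3pQ D' (fun t => u' (l t)) (fun t => u' (m t)) =
      a3pQ D (fun t => u (l t)) (fun t => u (m t)) := by
    refine Finset.sum_congr rfl fun i _ => Finset.sum_congr rfl fun j _ => congrArg _ ?_
    let w : Fin 6 → Fin 8 := ![l (i.succAbove 0), l (i.succAbove 1), l (i.succAbove 2),
      m (j.succAbove 0), m (j.succAbove 1), m (j.succAbove 2)]
    have key : r3Q (D' (u' (l i))) (u' ∘ w) = r3Q (D (u (l i))) (u ∘ w) :=
      r3Q_congr (k * c (l i)) (by simp [hk, hc]) (c ∘ w) (fun _ => hc _) fun p q r => by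
        simp only [Function.comp_apply]
        rw [h]
        ring
    have e1 : ∀ {X : Type} (v : Fin 8 → X), ![v (l (i.succAbove 0)), v (l (i.succAbove 1)),
        v (l (i.succAbove 2)), v (m (j.succAbove 0)), v (m (j.succAbove 1)),
        v (m (j.succAbove 2))] = v ∘ w := fun v => by
      funext t
      fin_cases t <;> rfl
    rw [e1 u, e1 u', key]
  have h2 : a3ppQ D' (fun t => u' (l t)) (fun t => u' (m t)) =
      a3ppQ D (fun t => u (l t)) (fun t => u (m t)) := by
    refine Finset.sum_congr rfl fun i _ => Finset.sum_congr rfl fun j _ => congrArg _ ?_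
    simp only [mu3, Function.comp_apply, crQ_rescale hk hc h]
  rw [a3Q, h1, h2, a3Q]

lemma phi22Q_rescale
    (hk : k ≠ 0) (hc : ∀ i, c i ≠ 0)
    (h : ∀ p q r s, D' (u' p) (u' q) (u' r) (u' s) =
      k * (c p * c q * c r * c s) * D (u p) (u q) (u r) (u s)) : phi22Q D' u' = phi22Q D u := by
  simp only [phi22Q, crQ_rescale hk hc h]

lemma phi31Q_rescale
    (hk : k ≠ 0) (hc : ∀ i, c i ≠ 0)
    (h : ∀ p q r s, D' (u' p) (u' q) (u' r) (u' s) =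
      k * (c p * c q * c r * c s) * D (u p) (u q) (u r) (u s))
    (hD : IsDet fun z : Fin 4 → ι => D (z 0) (z 1) (z 2) (z 3))
    (hne : ∀ z : Fin 4 → Fin 8, Function.Injective z →
      D (u (z 0)) (u (z 1)) (u (z 2)) (u (z 3)) ≠ 0) :
    phi31Q D' u' = phi31Q D u := by
  have hfs : ∀ z : Fin 4 → Fin 8, Function.Injective z →
      fs F (D' (u' (z 0)) (u' (z 1)) (u' (z 2)) (u' (z 3))) =
        fs F k + ∑ t, fs F (c (z t)) + fs F (D (u (z 0)) (u (z 1)) (u (z 2)) (u (z 3))) :=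
    fun z hz => by
      rw [h, fs_mul (by simp [hk, hc]) (hne z hz), fs_mul hk (by simp [hc]),
        fs_mul (by simp [hc]) (hc _), fs_mul (by simp [hc]) (hc _), fs_mul (hc _) (hc _),
        Fin.sum_univ_four]
  let e : FS F := (2 : ℚ) • fs F k + ∑ t, fs F (c t)
  have key := alt_a3Q_const hD u hne e
  rw [← add_zero (phi31Q D u), ← key]
  unfold phi31Q
  rw [← alt_add]
  refine congrArg alt (funext fun σ => ?_)
  rw [← TensorProduct.tmul_add]
  refine congrArg₂ (fun a b => clsB3 F a ⊗ₜ[ℚ] b) (a3Q_rescale hk hc h _ _) ?_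
  have h1 := hfs (fun t => σ (Fin.natAdd 4 t))
    (σ.injective.comp (Fin.natAdd_injective 4 4))
  have h2 := hfs (fun t => σ (Fin.castAdd 4 t))
    (σ.injective.comp (Fin.castAdd_injective 4 4))
  have h3 : ∑ t, fs F (c t) = ∑ t : Fin 4, fs F (c (σ (Fin.castAdd 4 t))) +
      ∑ t : Fin 4, fs F (c (σ (Fin.natAdd 4 t))) := by
    rw [← Equiv.sum_comp σ]
    exact Fin.sum_univ_add (fun t : Fin (4 + 4) => fs F (c (σ t)))
  refine (congrArg₂ (· + ·) h1 h2).trans ?_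
  simp only [e, h3, two_smul]
  abel

end Invariance

section Configurations

lemma phi_congr {ι : Type} {x : Fin 8 → Pt F 4} {D : ι → ι → ι → ι → F} {u : Fin 8 → ι}
    (h31 : phi31Q detPt x = phi31Q D u) (h22 : phi22Q detPt x = phi22Q D u) :
    phi x = (phi31Q D u, phi22Q D u) := by
  rw [phi_eq, h31, h22]

lemma phi_comp_perm (x : Fin 8 → Pt F 4) (σ : Perm (Fin 8)) :
    phi (x ∘ σ) = (sign σ : ℤ) • phi x := by
  rw [phi_eq, phi_eq, phi31Q_comp_perm, phi22Q_comp_perm]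
  rfl

lemma sum_smul_eq_zero {ψ : Fin 9 → T31 F × LamB2 F} {s : Fin 9 → T31 F} {t : Fin 9 → LamB2 F}
    (hψ : ∀ i, ψ i = (s i, t i)) (hs : ∑ i : Fin 9, ((-1 : ℤ) ^ (i : ℕ)) • s i = 0)
    (ht : ∑ i : Fin 9, ((-1 : ℤ) ^ (i : ℕ)) • t i = 0) :
    ∑ i : Fin 9, ((-1 : ℤ) ^ (i : ℕ)) • ψ i = 0 := by
  simp only [hψ]
  refine Prod.ext ?_ ?_
  · rw [Prod.fst_sum]
    exact hs
  · rw [Prod.snd_sum]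
    exact ht

lemma det4_eq_dt (v : Fin 4 → Fin 4 → F) : det4 (v 0) (v 1) (v 2) (v 3) = dt v := by
  unfold det4
  refine congrArg dt (funext fun i => ?_)
  fin_cases i <;> rfl

lemma isDet_detPt : IsDet fun z : Fin 4 → Pt F 4 => detPt (z 0) (z 1) (z 2) (z 3) :=
  ⟨fun a => a.rep, 1, fun z => by rw [one_mul]; exact det4_eq_dt fun i => (z i).rep⟩

lemma exists_mapPt_rep {N : ℕ} (g : (Fin N → F) ≃ₗ[F] (Fin N → F)) (x : Pt F N) :
    ∃ c : F, c ≠ 0 ∧ (mapPt g x).rep = c • g x.rep := by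
  have hx : mapPt g x = Projectivization.mk F (g x.rep)
      (by simpa using x.rep_nonzero) := by
    conv_lhs => rw [mapPt, ← x.mk_rep]
    exact Projectivization.map_mk _ _ _ _
  rw [hx]
  exact exists_rep_eq_smul _ _

lemma det4_smul (a b c d : F) (v : Fin 4 → Fin 4 → F) :
    det4 (a • v 0) (b • v 1) (c • v 2) (d • v 3) = a * b * c * d * dt v := by
  have := dt_smul ![a, b, c, d] v
  rw [Fin.prod_univ_four] at this
  exact (det4_eq_dt _).trans this

lemma Generic8.detPt_ne_zero {x : Fin 8 → Pt F 4} (hx : Generic8 x) (z : Fin 4 → Fin 8)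
    (hz : Function.Injective z) : detPt (x (z 0)) (x (z 1)) (x (z 2)) (x (z 3)) ≠ 0 := by
  apply hx <;> exact hz.ne (by decide)

lemma phi_mapPt {x : Fin 8 → Pt F 4} (hx : Generic8 x) (g : (Fin 4 → F) ≃ₗ[F] (Fin 4 → F)) :
    phi (mapPt g ∘ x) = phi x := by
  choose c hc hcx using fun i => exists_mapPt_rep g (x i)
  have h : ∀ p q r s, detPt ((mapPt g ∘ x) p) ((mapPt g ∘ x) q) ((mapPt g ∘ x) r)
      ((mapPt g ∘ x) s) = LinearMap.det g.toLinearMap * (c p * c q * c r * c s) *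
        detPt (x p) (x q) (x r) (x s) := fun p q r s => by
    let v : Fin 4 → Fin 4 → F := ![(x p).rep, (x q).rep, (x r).rep, (x s).rep]
    have h1 := det4_smul (c p) (c q) (c r) (c s) fun i => g (v i)
    have h2 := dt_map g.toLinearMap v
    simp only [detPt, Function.comp_apply, hcx]
    refine h1.trans ?_
    refine (congrArg _ h2).trans ?_
    rw [mul_left_comm, ← mul_assoc]
    rfl
  have hk : LinearMap.det g.toLinearMap ≠ 0 := (LinearEquiv.isUnit_det' g).ne_zero
  have h31 := phi31Q_rescale hk hc h isDet_detPt hx.detPt_ne_zero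
  have h22 := phi22Q_rescale hk hc h
  rw [phi_eq, phi_eq, h31, h22]

lemma phi_nine_term {x : Fin 9 → Pt F 4}
    (hx : ∀ z : Fin 4 → Fin 9, Function.Injective z →
      detPt (x (z 0)) (x (z 1)) (x (z 2)) (x (z 3)) ≠ 0) :
    ∑ i : Fin 9, ((-1 : ℤ) ^ (i : ℕ)) • phi (x ∘ i.succAbove) = 0 :=
by
  obtain ⟨D, hDx⟩ : ∃ D : Fin 9 → Fin 9 → Fin 9 → Fin 9 → F,
      ∀ a b c d, D a b c d = detPt (x a) (x b) (x c) (x d) := ⟨_, fun _ _ _ _ => rfl⟩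
  have hD : IsDet fun z : Fin 4 → Fin 9 => D (z 0) (z 1) (z 2) (z 3) := by
    simp only [hDx]
    exact isDet_detPt.comp x
  have hne : ∀ z : Fin 4 → Fin 9, Function.Injective z → D (z 0) (z 1) (z 2) (z 3) ≠ 0 :=
    fun z hz => by
      rw [hDx]
      exact hx z hz
  refine sum_smul_eq_zero (fun i => ?_) (phi31_nine_term hD hne) (phi22Q_nine_term D)
  have h : ∀ p q r s : Fin 8, detPt ((x ∘ i.succAbove) p) ((x ∘ i.succAbove) q)
      ((x ∘ i.succAbove) r) ((x ∘ i.succAbove) s) = 1 * (1 * 1 * 1 * 1) *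
        D (i.succAbove p) (i.succAbove q) (i.succAbove r) (i.succAbove s) := fun p q r s => by
    rw [hDx, mul_one, mul_one, mul_one, mul_one, one_mul]
    rfl
  have hi : ∀ z : Fin 4 → Fin 8, Function.Injective z →
      D (i.succAbove (z 0)) (i.succAbove (z 1)) (i.succAbove (z 2)) (i.succAbove (z 3)) ≠ 0 :=
    fun z hz => hne (i.succAbove ∘ z) (Fin.succAbove_right_injective.comp hz)
  exact phi_congr
    (phi31Q_rescale (c := fun _ => 1) one_ne_zero (fun _ => one_ne_zero) h hD hi)
    (phi22Q_rescale (c := fun _ => 1) one_ne_zero (fun _ => one_ne_zero) h)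

/-- Projection from a point is induced by a linear map with this point as its kernel. -/
lemma exists_projection_rep (p : Pt F 5) :
    ∃ L : (Fin 5 → F) →ₗ[F] (Fin 4 → F), Function.Surjective L ∧ L p.rep = 0 ∧
      ∀ y : Pt F 5, L y.rep ≠ 0 → ∃ c : F, c ≠ 0 ∧
        (projection 3 (fun _ : Fin 1 => p) y).rep = c • L y.rep := by
  let W : Submodule F (Fin 5 → F) := Submodule.span F (Set.range fun _ : Fin 1 => p.rep)
  have hW : Module.finrank F W = 1 := by
    have : W = F ∙ p.rep := by
      simp only [W, Set.range_const]
    rw [this]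
    exact finrank_span_singleton p.rep_nonzero
  have h : Module.finrank F ((Fin 5 → F) ⧸ W) = 3 + 1 := by
    have h1 := W.finrank_quotient_add_finrank
    rw [hW, Module.finrank_fin_fun] at h1
    omega
  let E := ((Module.finBasis F ((Fin 5 → F) ⧸ W)).reindex (finCongr h)).equivFun
  refine ⟨E.toLinearMap.comp W.mkQ, E.surjective.comp W.mkQ_surjective, ?_, fun y hy => ?_⟩
  · have : W.mkQ p.rep = 0 :=
      (Submodule.Quotient.mk_eq_zero W).2 (Submodule.subset_span ⟨0, rfl⟩)
    rw [LinearMap.comp_apply, this, map_zero]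
  · have hp : projection 3 (fun _ : Fin 1 => p) y =
        Projectivization.mk F (E (Submodule.Quotient.mk y.rep)) hy := by
      unfold projection
      exact (dif_pos h).trans (dif_pos hy)
    rw [hp]
    exact exists_rep_eq_smul _ hy

lemma dt_eq_five (v : Fin 5 → Fin 5 → F) : dt ![v 0, v 1, v 2, v 3, v 4] = dt v := by
  refine congrArg dt (funext fun i => ?_)
  fin_cases i <;> rfl

lemma phi_dual_nine_term {x : Fin 9 → Pt F 5}
    (hx : ∀ z : Fin 5 → Fin 9, Function.Injective z → dt (fun i => (x (z i)).rep) ≠ 0) :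
    ∑ i : Fin 9, ((-1 : ℤ) ^ (i : ℕ)) •
      phi (projection 3 (fun _ : Fin 1 => x i) ∘ (x ∘ i.succAbove)) = 0 := by
  let G : Fin 9 → Fin 9 → Fin 9 → Fin 9 → Fin 9 → F := fun a b c d e =>
    dt fun i => (x ((![a, b, c, d, e] : Fin 5 → Fin 9) i)).rep
  have hGz : ∀ z : Fin 5 → Fin 9, G (z 0) (z 1) (z 2) (z 3) (z 4) = dt fun i => (x (z i)).rep :=
    fun z => congrArg dt (funext fun i => by fin_cases i <;> rfl)
  have hG : IsDet fun z : Fin 5 → Fin 9 => G (z 0) (z 1) (z 2) (z 3) (z 4) :=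
    ⟨fun a => (x a).rep, 1, fun z => (hGz z).trans (one_mul _).symm⟩
  have hne : ∀ z : Fin 5 → Fin 9, Function.Injective z →
      G (z 0) (z 1) (z 2) (z 3) (z 4) ≠ 0 := fun z hz => by
    rw [hGz]
    exact hx z hz
  refine sum_smul_eq_zero (fun i => ?_) (phi31_dual_nine_term hG hne)
    (phi22Q_dual_nine_term hG hne)
  obtain ⟨L, hL, hLp, hrep⟩ := exists_projection_rep (x i)
  obtain ⟨κ, hκ, hdt⟩ := exists_dt_proj L hL (x i).rep_nonzero hLp
  have hdtG : ∀ z : Fin 4 → Fin 9, dt (fun t => L (x (z t)).rep) =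
      κ * G i (z 0) (z 1) (z 2) (z 3) := fun z => by
    refine (hdt fun t => (x (z t)).rep).trans (congrArg _ (congrArg dt (funext fun t => ?_)))
    fin_cases t <;> rfl
  have hneG : ∀ z : Fin 4 → Fin 8, Function.Injective z →
      G i (i.succAbove (z 0)) (i.succAbove (z 1)) (i.succAbove (z 2)) (i.succAbove (z 3)) ≠ 0 :=
    fun z hz => hne (Fin.cons i (i.succAbove ∘ z)) (Fin.cons_injective_iff.2
      ⟨fun ⟨t, ht⟩ => i.succAbove_ne _ ht, Fin.succAbove_right_injective.comp hz⟩)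
  have hLne : ∀ t : Fin 8, L (x (i.succAbove t)).rep ≠ 0 := fun t h0 => by
    obtain ⟨z, hz, hz0⟩ : ∃ z : Fin 4 → Fin 8, Function.Injective z ∧ z 0 = t :=
      ⟨fun s => Fin.castAdd 4 s + t, fun a b hab => Fin.castAdd_injective 4 4
        (add_right_cancel hab), by simp⟩
    refine hneG z hz ?_
    have h1 := hdtG (i.succAbove ∘ z)
    have h2 : dt (fun s => L (x ((i.succAbove ∘ z) s)).rep) = 0 :=
      Matrix.det_eq_zero_of_row_eq_zero 0 fun j => by
        simp only [Matrix.of_apply, Function.comp_apply, hz0, h0, Pi.zero_apply]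
    rw [h2] at h1
    exact (mul_eq_zero.mp h1.symm).resolve_left hκ
  choose c hc hcx using fun t => hrep (x (i.succAbove t)) (hLne t)
  have h : ∀ p q r s, detPt ((projection 3 (fun _ : Fin 1 => x i) ∘ (x ∘ i.succAbove)) p)
      ((projection 3 (fun _ : Fin 1 => x i) ∘ (x ∘ i.succAbove)) q)
      ((projection 3 (fun _ : Fin 1 => x i) ∘ (x ∘ i.succAbove)) r)
      ((projection 3 (fun _ : Fin 1 => x i) ∘ (x ∘ i.succAbove)) s) =
      κ * (c p * c q * c r * c s) *
        G i (i.succAbove p) (i.succAbove q) (i.succAbove r) (i.succAbove s) := fun p q r s => by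
    have h1 := det4_smul (c p) (c q) (c r) (c s) fun t =>
      L (x (i.succAbove ((![p, q, r, s] : Fin 4 → Fin 8) t))).rep
    have h2 := hdtG fun t => i.succAbove ((![p, q, r, s] : Fin 4 → Fin 8) t)
    simp only [detPt, Function.comp_apply, hcx]
    refine h1.trans ((congrArg _ h2).trans ?_)
    rw [mul_left_comm, ← mul_assoc]
    rfl
  exact phi_congr (phi31Q_rescale hκ hc h (hG.cons i) hneG) (phi22Q_rescale hκ hc h)

end Configurations

end Cobracket

/-- Theorem 5.1 a.  The degree-four cobracket is well defined: the
(linear extension of the) map `φ = ((a_3 ⊗ id - id ⊗ a_3) ∘ (δ_{3,1}, δ_{1,3}), δ_{2,2})`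
sends to zero all the defining relations of `G̃_4(F)`: projective invariance,
skew-symmetry, the 9-term relation in `P³(F)` and the dual 9-term relation in `P⁴(F)`. -/
theorem statement13 (F : Type) [Field F] :
    -- 1) projective invariance
    (∀ x : Fin 8 → Pt F 4, Generic8 x → ∀ g : (Fin 4 → F) ≃ₗ[F] (Fin 4 → F),
      phi (mapPt g ∘ x) = phi x) ∧
    -- 2) skew-symmetry
    (∀ x : Fin 8 → Pt F 4, Generic8 x → ∀ σ : Equiv.Perm (Fin 8),
      phi (x ∘ σ) = (Equiv.Perm.sign σ : ℤ) • phi x) ∧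
    -- 3) the 9-term relation, for 9 generic points of P³(F)
    (∀ x : Fin 9 → Pt F 4,
      (∀ a b c d : Fin 9, a ≠ b → a ≠ c → a ≠ d → b ≠ c → b ≠ d → c ≠ d →
        det4 (x a).rep (x b).rep (x c).rep (x d).rep ≠ 0) →
      ∑ i : Fin 9, ((-1 : ℤ) ^ (i : ℕ)) • phi (x ∘ i.succAbove) = 0) ∧
    -- 4) the dual 9-term relation, for 9 generic points of P⁴(F)
    (∀ x : Fin 9 → Pt F 5,
      (∀ a b c d e : Fin 9, a ≠ b → a ≠ c → a ≠ d → a ≠ e → b ≠ c → b ≠ d → b ≠ e →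
        c ≠ d → c ≠ e → d ≠ e →
        dt ![(x a).rep, (x b).rep, (x c).rep, (x d).rep, (x e).rep] ≠ 0) →
      ∑ i : Fin 9, ((-1 : ℤ) ^ (i : ℕ)) •
        phi (projection 3 (fun _ : Fin 1 => x i) ∘ (x ∘ i.succAbove)) = 0) := by
  refine ⟨fun x hx g => phi_mapPt hx g, fun x _ σ => phi_comp_perm x σ, fun x hx =>
    phi_nine_term fun z hz => ?_, fun x hx => phi_dual_nine_term fun z hz => ?_⟩
  · apply hx <;> exact hz.ne (by decide)
  · rw [← dt_eq_five]
    apply hx <;> exact hz.ne (by decide)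

end Gon
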